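/- There exist absolute constants c > 0 and C > 0 such that the following holds. Let F be a field and let A ⊆ F be a finite set with |A| ≥ 2. If F has positive characteristic p, assume |A| ≤ c · p^{2/3}. Then there exists a point q ∈ A × A such that |Δ_q(A × A)| ≥ C · |A|^{5/4}, where A × A = {(x,y) ∈ F^2 : x ∈ A, y ∈ A}. -/

import Mathlib

open scoped Classical

/-- The squared Euclidean distance between two points of `F^2`. -/
def sqDist {F : Type*} [Field F] (q r : F × F) : F :=
  (q.1 - r.1) ^ 2 + (q.2 - r.2) ^ 2

/-- The set of squared distances pinned at a point `q`. -/
noncomputable def pinnedDists {F : Type*} [Field F] (q : F × F) (P : Finset (F × F)) :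
    Finset F :=
  P.image (fun r => sqDist q r)

open MvPolynomial (totalDegree pderiv)
open Polynomial (derivative)

/-- A line `{(t, y₀ + s t, z₀ + s² t)}` in affine three-space, whose direction `(1, s, s²)` is
null for the quadratic form `y² - xz`. -/
@[ext]
structure NullLine (K : Type*) where
  /-- the parameter `s` of the direction -/
  slope : K
  /-- the second coordinate at `t = 0` -/
  y₀ : K
  /-- the third coordinate at `t = 0` -/
  z₀ : K

namespace NullLine

variable {K : Type*} [Field K]

/-- The point of a null line with first coordinate `t`. -/
def point (l : NullLine K) (t : K) : Fin 3 → K :=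
  ![t, l.y₀ + l.slope * t, l.z₀ + l.slope ^ 2 * t]

/-- Restriction of polynomials to a null line. -/
noncomputable def res (l : NullLine K) : MvPolynomial (Fin 3) K →ₐ[K] Polynomial K :=
  MvPolynomial.aeval ![Polynomial.X, Polynomial.C l.y₀ + Polynomial.C l.slope * Polynomial.X,
    Polynomial.C l.z₀ + Polynomial.C (l.slope ^ 2) * Polynomial.X]

theorem eval_res (l : NullLine K) (f : MvPolynomial (Fin 3) K) (t : K) :
    (l.res f).eval t = MvPolynomial.eval (l.point t) f := by
  induction f using MvPolynomial.induction_on with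
  | C a => simp [res]
  | add p q hp hq => simp [hp, hq]
  | mul_X p i hp =>
    rw [map_mul, Polynomial.eval_mul, hp, map_mul]
    congr 1
    fin_cases i <;> simp [res, point]

theorem natDegree_res_le (l : NullLine K) (f : MvPolynomial (Fin 3) K) :
    (l.res f).natDegree ≤ f.totalDegree := by
  have key : ∀ a b : K, (Polynomial.C a + Polynomial.C b * Polynomial.X).natDegree ≤ 1 :=
    fun a b => by compute_degree
  rw [res, MvPolynomial.aeval_def, MvPolynomial.eval₂_eq]
  refine Polynomial.natDegree_sum_le_of_forall_le _ _ fun d hd => ?_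
  refine (Polynomial.natDegree_C_mul_le _ _).trans ?_
  refine (Polynomial.natDegree_prod_le _ _).trans ?_
  refine le_trans ?_ (MvPolynomial.le_totalDegree hd)
  rw [Finsupp.sum]
  refine Finset.sum_le_sum fun i _ => ?_
  refine Polynomial.natDegree_pow_le.trans ?_
  refine (Nat.mul_le_mul_left _ (?_ : _ ≤ 1)).trans (by simp)
  fin_cases i
  · exact Polynomial.natDegree_X_le
  · exact key _ _
  · exact key _ _

/-- The derivation along the direction `(1, s, s²)`. -/
noncomputable def nullDeriv (s : K) (f : MvPolynomial (Fin 3) K) : MvPolynomial (Fin 3) K :=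
  pderiv 0 f + MvPolynomial.C s * pderiv 1 f + MvPolynomial.C (s ^ 2) * pderiv 2 f

theorem res_X_zero (l : NullLine K) : l.res (MvPolynomial.X 0) = Polynomial.X := by
  simp [res]

theorem res_X_one (l : NullLine K) : l.res (MvPolynomial.X 1) =
    Polynomial.C l.y₀ + Polynomial.C l.slope * Polynomial.X := by
  simp [res]

theorem res_X_two (l : NullLine K) : l.res (MvPolynomial.X 2) =
    Polynomial.C l.z₀ + Polynomial.C (l.slope ^ 2) * Polynomial.X := by
  simp [res]

theorem res_C (l : NullLine K) (a : K) : l.res (MvPolynomial.C a) = Polynomial.C a :=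
  MvPolynomial.algHom_C _ a

theorem nullDeriv_X_zero (s : K) : nullDeriv s (MvPolynomial.X 0) = 1 := by
  simp [nullDeriv]

theorem nullDeriv_X_one (s : K) : nullDeriv s (MvPolynomial.X 1) = MvPolynomial.C s := by
  simp [nullDeriv]

theorem nullDeriv_X_two (s : K) : nullDeriv s (MvPolynomial.X 2) = MvPolynomial.C (s ^ 2) := by
  simp [nullDeriv]

theorem derivative_res (l : NullLine K) (f : MvPolynomial (Fin 3) K) :
    derivative (l.res f) = l.res (nullDeriv l.slope f) := by
  induction f using MvPolynomial.induction_on with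
  | C a => simp [res, nullDeriv]
  | add p q hp hq =>
    rw [map_add, map_add, hp, hq, ← map_add]
    congr 1
    simp only [nullDeriv, map_add]
    ring
  | mul_X p i hp =>
    have h : nullDeriv l.slope (p * MvPolynomial.X i) =
        nullDeriv l.slope p * MvPolynomial.X i + p * nullDeriv l.slope (MvPolynomial.X i) := by
      simp only [nullDeriv, Derivation.leibniz, smul_eq_mul]
      ring
    rw [map_mul, Polynomial.derivative_mul, hp, h, map_add, map_mul, map_mul]
    congr 2
    fin_cases i
    · change derivative (l.res (MvPolynomial.X 0)) =
        l.res (nullDeriv l.slope (MvPolynomial.X 0))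
      rw [res_X_zero, nullDeriv_X_zero, map_one, Polynomial.derivative_X]
    · change derivative (l.res (MvPolynomial.X 1)) =
        l.res (nullDeriv l.slope (MvPolynomial.X 1))
      rw [res_X_one, nullDeriv_X_one, res_C, Polynomial.derivative_add, Polynomial.derivative_C,
        Polynomial.derivative_C_mul, Polynomial.derivative_X, zero_add, mul_one]
    · change derivative (l.res (MvPolynomial.X 2)) =
        l.res (nullDeriv l.slope (MvPolynomial.X 2))
      rw [res_X_two, nullDeriv_X_two, res_C, Polynomial.derivative_add, Polynomial.derivative_C,
        Polynomial.derivative_C_mul, Polynomial.derivative_X, zero_add, mul_one]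

theorem res_eq_zero_of_eval_eq_zero (l : NullLine K) {f : MvPolynomial (Fin 3) K} (T : Finset K)
    (hT : ∀ t ∈ T, MvPolynomial.eval (l.point t) f = 0) (hf : f.totalDegree < T.card) :
    l.res f = 0 :=
  Polynomial.eq_zero_of_natDegree_lt_card_of_eval_eq_zero' _ T
    (fun t ht => by rw [eval_res, hT t ht]) ((l.natDegree_res_le f).trans_lt hf)

theorem eval_point_of_res_eq_zero {l : NullLine K} {f : MvPolynomial (Fin 3) K}
    (h : l.res f = 0) (t : K) : MvPolynomial.eval (l.point t) f = 0 := by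
  rw [← eval_res, h, Polynomial.eval_zero]

theorem totalDegree_pderiv_le {σ : Type*} (i : σ) (f : MvPolynomial σ K) :
    (pderiv i f).totalDegree ≤ f.totalDegree - 1 := by
  conv_lhs => rw [f.as_sum, map_sum]
  refine (MvPolynomial.totalDegree_finsetSum _ _).trans (Finset.sup_le fun d hd => ?_)
  rw [MvPolynomial.pderiv_monomial]
  by_cases h : d i = 0
  · simp [h]
  refine (MvPolynomial.totalDegree_monomial_le _ _).trans ?_
  have h1 : d.sum (fun _ e => e) ≤ f.totalDegree := MvPolynomial.le_totalDegree hd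
  have h2 : (d - Finsupp.single i 1) + Finsupp.single i 1 = d :=
    tsub_add_cancel_of_le (by simpa using Nat.one_le_iff_ne_zero.mpr h)
  have h3 := congrArg Finsupp.degree h2
  rw [map_add, Finsupp.degree_single] at h3
  have h4 : d.sum (fun _ e => e) = d.degree := rfl
  change (d - Finsupp.single i 1).degree ≤ _
  omega

end NullLine

theorem six_mul_choose_three (m : ℕ) :
    6 * (m + 3).choose 3 = (m + 1) * (m + 2) * (m + 3) := by
  have h := Nat.ascFactorial_eq_factorial_mul_choose m 3
  simp only [Nat.ascFactorial, Nat.factorial] at h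
  linarith

theorem finrank_restrictTotalDegree_fin_three (K : Type*) [Field K] (m : ℕ) :
    Module.finrank K (MvPolynomial.restrictTotalDegree (Fin 3) K m) = (m + 3).choose 3 := by
  rw [MvPolynomial.restrictTotalDegree,
    Module.finrank_eq_nat_card_basis (MvPolynomial.basisRestrictSupport K _)]
  have h : {n : Fin 3 →₀ ℕ | (n.sum fun _ e => e) ≤ m} =
      ((Finset.range (m + 1)).biUnion fun i =>
        Finset.finsuppAntidiag (Finset.univ : Finset (Fin 3)) i : Finset (Fin 3 →₀ ℕ)) := by
    ext n
    have h0 : (n.sum fun _ e => e) = Finset.univ.sum ⇑n := Finsupp.sum_fintype _ _ fun _ => rfl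
    simp [h0]
  rw [h, Nat.card_coe_set_eq, Set.ncard_coe_finset, Finset.card_biUnion]
  · simp only [Finset.card_finsuppAntidiag_nat_eq_choose, Finset.card_univ, Fintype.card_fin]
    have := Nat.sum_range_add_choose m 2
    rw [← this]
    refine Finset.sum_congr rfl fun i _ => ?_
    rw [show 3 + i - 1 = i + 2 by omega]
    exact Nat.choose_symm_of_eq_add rfl
  · intro i _ j _ hij
    refine Finset.disjoint_left.mpr fun n hi hj => hij ?_
    rw [Finset.mem_finsuppAntidiag] at hi hj
    exact hi.1.symm.trans hj.1

namespace NullLine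

variable {K : Type*} [Field K]

/-- Polynomials of total degree at most `m` vanishing on the null lines in `T`. -/
noncomputable def vanishing (m : ℕ) (T : Finset (NullLine K)) :
    Submodule K (MvPolynomial (Fin 3) K) where
  carrier := {f | f.totalDegree ≤ m ∧ ∀ l ∈ T, l.res f = 0}
  add_mem' := fun {f g} hf hg =>
    ⟨(MvPolynomial.totalDegree_add f g).trans (max_le hf.1 hg.1), fun l hl => by
      rw [map_add, hf.2 l hl, hg.2 l hl, add_zero]⟩
  zero_mem' := ⟨by simp, by simp⟩
  smul_mem' := fun c f hf =>
    ⟨(MvPolynomial.totalDegree_smul_le c f).trans hf.1, fun l hl => by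
      rw [map_smul, hf.2 l hl, smul_zero]⟩

theorem mem_vanishing {m : ℕ} {T : Finset (NullLine K)} {f : MvPolynomial (Fin 3) K} :
    f ∈ vanishing m T ↔ f.totalDegree ≤ m ∧ ∀ l ∈ T, l.res f = 0 := Iff.rfl

theorem vanishing_empty (m : ℕ) :
    vanishing m (∅ : Finset (NullLine K)) = MvPolynomial.restrictTotalDegree (Fin 3) K m := by
  ext f
  simp [mem_vanishing, MvPolynomial.mem_restrictTotalDegree]

theorem finrank_vanishing_empty (m : ℕ) :
    Module.finrank K (vanishing m (∅ : Finset (NullLine K))) = (m + 3).choose 3 := by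
  rw [vanishing_empty, finrank_restrictTotalDegree_fin_three]

instance finite_vanishing (m : ℕ) (T : Finset (NullLine K)) :
    Module.Finite K (vanishing m T) := by
  have h : vanishing m T ≤ MvPolynomial.restrictTotalDegree (Fin 3) K m := fun f hf =>
    (MvPolynomial.mem_restrictTotalDegree (Fin 3) m f).mpr hf.1
  exact Module.Finite.of_injective (Submodule.inclusion h) (Submodule.inclusion_injective h)

theorem finrank_vanishing_insert (m : ℕ) (T : Finset (NullLine K)) (v : NullLine K) :
    Module.finrank K ((vanishing m T).map v.res.toLinearMap) +
      Module.finrank K (vanishing m (insert v T)) = Module.finrank K (vanishing m T) := by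
  rw [← LinearMap.finrank_range_add_finrank_ker (v.res.toLinearMap.domRestrict (vanishing m T)),
    LinearMap.range_domRestrict]
  congr 1
  rw [LinearMap.ker_domRestrict]
  have h : vanishing m (insert v T) ≤ vanishing m T := fun f hf =>
    ⟨hf.1, fun l hl => hf.2 l (Finset.mem_insert_of_mem hl)⟩
  rw [← (Submodule.submoduleOfEquivOfLe h).finrank_eq]
  suffices hs : (vanishing m (insert v T)).submoduleOf (vanishing m T) =
      v.res.toLinearMap.ker.comap (vanishing m T).subtype by rw [hs]
  ext f
  simp only [Submodule.submoduleOf, Submodule.mem_comap, Submodule.subtype_apply,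
    LinearMap.mem_ker, Finset.forall_mem_insert, mem_vanishing]
  exact ⟨fun h => h.2.1, fun h => ⟨f.2.1, h, f.2.2⟩⟩

theorem finrank_degreeLT (n : ℕ) : Module.finrank K (Polynomial.degreeLT K n) = n := by
  rw [(Polynomial.degreeLTEquiv K n).finrank_eq, Module.finrank_fin_fun]

instance finite_degreeLT (n : ℕ) : Module.Finite K (Polynomial.degreeLT K n) :=
  Module.Finite.equiv (Polynomial.degreeLTEquiv K n).symm

/-- Imposing vanishing on a further line `v` costs at most `m + 1 - h` conditions if `v` already
meets `h` of the lines. -/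
theorem finrank_vanishing_le_insert (m : ℕ) (T : Finset (NullLine K)) (v : NullLine K)
    (H : Finset K) (hH : ∀ t ∈ H, ∃ l ∈ T, l.point t = v.point t) :
    Module.finrank K (vanishing m T) ≤
      Module.finrank K (vanishing m (insert v T)) + (m + 1 - H.card) := by
  rw [← finrank_vanishing_insert m T v, add_comm]
  refine Nat.add_le_add_left ?_ _
  set c : Polynomial K := ∏ t ∈ H, (Polynomial.X - Polynomial.C t) with hc
  have hcm : c.Monic := Polynomial.monic_prod_of_monic _ _ fun t _ => Polynomial.monic_X_sub_C t
  have hcd : c.natDegree = H.card := by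
    rw [hc, Polynomial.natDegree_prod_of_monic _ _ fun t _ => Polynomial.monic_X_sub_C t]
    simp
  have hle : (vanishing m T).map v.res.toLinearMap ≤
      (Polynomial.degreeLT K (m + 1 - H.card)).map (LinearMap.mulLeft K c) := by
    rintro _ ⟨f, hf, rfl⟩
    change v.res f ∈ _
    have hdvd : c ∣ v.res f := by
      refine Finset.prod_dvd_of_coprime (fun a _ b _ hab => ?_) fun t ht => ?_
      · exact Polynomial.isCoprime_X_sub_C_of_isUnit_sub (sub_ne_zero.mpr hab).isUnit
      · rw [Polynomial.dvd_iff_isRoot, Polynomial.IsRoot, eval_res]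
        obtain ⟨l, hl, hlt⟩ := hH t ht
        rw [← hlt]
        exact eval_point_of_res_eq_zero (hf.2 l hl) t
    obtain ⟨q, hq⟩ := hdvd
    refine ⟨q, ?_, hq.symm⟩
    rw [SetLike.mem_coe, Polynomial.mem_degreeLT]
    by_cases hq0 : q = 0
    · rw [hq0, Polynomial.degree_zero]
      exact WithBot.bot_lt_coe _
    have h1 := (v.natDegree_res_le f).trans hf.1
    rw [hq, hcm.natDegree_mul' hq0, hcd] at h1
    rw [Polynomial.degree_eq_natDegree hq0]
    exact_mod_cast (by omega : q.natDegree < m + 1 - H.card)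
  refine (Submodule.finrank_mono hle).trans ((Submodule.finrank_map_le _ _).trans ?_)
  rw [finrank_degreeLT]

theorem exists_separator {l v : NullLine K} (h : l ≠ v) :
    ∃ f : MvPolynomial (Fin 3) K, f.totalDegree ≤ 1 ∧ l.res f = 0 ∧ v.res f ≠ 0 := by
  have hX : ∀ i, (MvPolynomial.X i : MvPolynomial (Fin 3) K).totalDegree ≤ 1 := fun i =>
    (MvPolynomial.totalDegree_X i).le
  have key : ∀ (i : Fin 3) (a b : K),
      (MvPolynomial.X i - MvPolynomial.C a - MvPolynomial.C b * MvPolynomial.X 0 :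
        MvPolynomial (Fin 3) K).totalDegree ≤ 1 := by
    intro i a b
    refine (MvPolynomial.totalDegree_sub _ _).trans (max_le ?_ ?_)
    · exact (MvPolynomial.totalDegree_sub_C_le _ _).trans (hX i)
    · refine (MvPolynomial.totalDegree_mul _ _).trans ?_
      rw [MvPolynomial.totalDegree_C, zero_add]
      exact hX 0
  have hne : ∀ a b : K, Polynomial.C a + Polynomial.C b * Polynomial.X = 0 → a = 0 ∧ b = 0 := by
    intro a b hab
    constructor
    · simpa using congrArg (fun p => Polynomial.coeff p 0) hab
    · simpa using congrArg (fun p => Polynomial.coeff p 1) hab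
  by_contra hcon
  push Not at hcon
  have h1 := hcon _ (key 1 l.y₀ l.slope) (by
    rw [map_sub, map_sub, map_mul, res_C, res_C, res_X_one, res_X_zero]; ring)
  have h2 := hcon _ (key 2 l.z₀ (l.slope ^ 2)) (by
    rw [map_sub, map_sub, map_mul, res_C, res_C, res_X_two, res_X_zero]; ring)
  rw [map_sub, map_sub, map_mul, res_C, res_C, res_X_one, res_X_zero] at h1
  rw [map_sub, map_sub, map_mul, res_C, res_C, res_X_two, res_X_zero] at h2
  have h1' := hne (v.y₀ - l.y₀) (v.slope - l.slope) (by
    rw [← h1, Polynomial.C_sub, Polynomial.C_sub]; ring)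
  have h2' := hne (v.z₀ - l.z₀) (v.slope ^ 2 - l.slope ^ 2) (by
    rw [← h2, Polynomial.C_sub, Polynomial.C_sub]; ring)
  exact h (NullLine.ext (sub_eq_zero.mp h1'.2).symm (sub_eq_zero.mp h1'.1).symm
    (sub_eq_zero.mp h2'.1).symm)

/-- Vanishing on a further line imposes at least `m + 1 - |T|` conditions. -/
theorem finrank_vanishing_insert_le (m : ℕ) (T : Finset (NullLine K)) (v : NullLine K)
    (hv : v ∉ T) :
    Module.finrank K (vanishing m (insert v T)) + (m + 1 - T.card) ≤
      Module.finrank K (vanishing m T) := by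
  rw [← finrank_vanishing_insert m T v, add_comm]
  refine Nat.add_le_add_right ?_ _
  have hsep : ∀ l : NullLine K, ∃ f : MvPolynomial (Fin 3) K,
      l ∈ T → f.totalDegree ≤ 1 ∧ l.res f = 0 ∧ v.res f ≠ 0 := by
    intro l
    by_cases hl : l ∈ T
    · obtain ⟨f, hf⟩ := exists_separator (l := l) (v := v) (fun h => hv (h ▸ hl))
      exact ⟨f, fun _ => hf⟩
    · exact ⟨0, fun h => absurd h hl⟩
  choose φ hφ using hsep
  set P := ∏ l ∈ T, φ l with hP
  have hPd : P.totalDegree ≤ T.card := by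
    refine (MvPolynomial.totalDegree_finsetProd _ _).trans ?_
    refine (Finset.sum_le_sum fun l hl => (hφ l hl).1).trans ?_
    simp
  have hPv : v.res P ≠ 0 := by
    rw [hP, map_prod]
    exact Finset.prod_ne_zero_iff.mpr fun l hl => (hφ l hl).2.2
  have hle : (Polynomial.degreeLT K (m + 1 - T.card)).map (LinearMap.mulLeft K (v.res P)) ≤
      (vanishing m T).map v.res.toLinearMap := by
    rintro _ ⟨q, hq, rfl⟩
    rw [SetLike.mem_coe, Polynomial.mem_degreeLT] at hq
    by_cases hq0 : q = 0
    · rw [hq0, map_zero]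
      exact Submodule.zero_mem _
    rw [Polynomial.degree_eq_natDegree hq0] at hq
    have hq' : q.natDegree < m + 1 - T.card := by exact_mod_cast hq
    refine ⟨P * Polynomial.aeval (MvPolynomial.X 0) q, ⟨?_, ?_⟩, ?_⟩
    · refine (MvPolynomial.totalDegree_mul _ _).trans ?_
      have : (Polynomial.aeval (MvPolynomial.X 0 : MvPolynomial (Fin 3) K) q).totalDegree ≤
          q.natDegree := by
        rw [Polynomial.aeval_eq_sum_range]
        refine MvPolynomial.totalDegree_finsetSum_le fun i hi => ?_
        refine (MvPolynomial.totalDegree_smul_le _ _).trans ?_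
        rw [MvPolynomial.totalDegree_X_pow]
        exact Nat.lt_succ_iff.mp (Finset.mem_range.mp hi)
      omega
    · intro l hl
      rw [map_mul, hP, map_prod, Finset.prod_eq_zero hl (hφ l hl).2.1, zero_mul]
    · change v.res _ = v.res P * q
      rw [map_mul, ← Polynomial.aeval_algHom_apply, res_X_zero, Polynomial.aeval_X_left_apply]
  refine le_trans ?_ (Submodule.finrank_mono hle)
  rw [← (Submodule.equivMapOfInjective _ (mul_right_injective₀ hPv) _).finrank_eq,
    finrank_degreeLT]

theorem finrank_vanishing_add_le (m : ℕ) (T : Finset (NullLine K)) :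
    Module.finrank K (vanishing m T) + T.card * (m + 1 - T.card) ≤ (m + 3).choose 3 := by
  have key : ∀ N : ℕ, ∀ T : Finset (NullLine K), T.card ≤ N →
      Module.finrank K (vanishing m T) + T.card * (m + 1 - N) ≤ (m + 3).choose 3 := by
    intro N T
    induction T using Finset.induction_on with
    | empty => simp [finrank_vanishing_empty]
    | insert v T hv ih =>
      intro hN
      rw [Finset.card_insert_of_notMem hv] at hN ⊢
      have h1 := ih (by omega)
      have h2 := finrank_vanishing_insert_le m T v hv
      rw [add_mul, one_mul]
      omega
  exact key _ T le_rfl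

/-- A Bézout-type bound: two coprime polynomials have at most `deg f * deg g` common null
lines. -/
theorem card_le_of_isRelPrime {f g : MvPolynomial (Fin 3) K} (hf : f ≠ 0) (hg : g ≠ 0)
    (hfg : IsRelPrime f g) (T : Finset (NullLine K))
    (hT : ∀ l ∈ T, l.res f = 0 ∧ l.res g = 0) :
    T.card ≤ f.totalDegree * g.totalDegree := by
  by_contra! hcard
  obtain ⟨T', hT'T, hT'⟩ := Finset.exists_subset_card_eq (Nat.succ_le_of_lt hcard)
  set d := f.totalDegree with hd
  set e := g.totalDegree with he
  set N := (d * e).succ with hN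
  set r := N ^ 2 + N with hr
  set m := d + e + r with hm
  let V : ℕ → Submodule K (MvPolynomial (Fin 3) K) := fun k => vanishing k ∅
  have hV : ∀ k, Module.finrank K (V k) = (k + 3).choose 3 := finrank_vanishing_empty
  have hmul : ∀ h : MvPolynomial (Fin 3) K, h ≠ 0 → ∀ k,
      Module.finrank K ((V k).map (LinearMap.mulLeft K h)) = (k + 3).choose 3 := by
    intro h hh k
    rw [← hV k]
    exact (Submodule.equivMapOfInjective _ (mul_right_injective₀ hh) _).finrank_eq.symm
  have h1 : (V (e + r)).map (LinearMap.mulLeft K f) ≤ vanishing m T' := by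
    rintro _ ⟨q, hq, rfl⟩
    refine ⟨(MvPolynomial.totalDegree_mul _ _).trans ?_, fun l hl => ?_⟩
    · have : q.totalDegree ≤ e + r := hq.1
      omega
    · change l.res (f * q) = 0
      rw [map_mul, (hT l (hT'T hl)).1, zero_mul]
  have h2 : (V (d + r)).map (LinearMap.mulLeft K g) ≤ vanishing m T' := by
    rintro _ ⟨q, hq, rfl⟩
    refine ⟨(MvPolynomial.totalDegree_mul _ _).trans ?_, fun l hl => ?_⟩
    · have : q.totalDegree ≤ d + r := hq.1
      omega
    · change l.res (g * q) = 0
      rw [map_mul, (hT l (hT'T hl)).2, zero_mul]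
  have h3 : (V (e + r)).map (LinearMap.mulLeft K f) ⊓ (V (d + r)).map (LinearMap.mulLeft K g) ≤
      (V r).map (LinearMap.mulLeft K (f * g)) := by
    rintro _ ⟨⟨a, ha, rfl⟩, ⟨b, hb, hab⟩⟩
    change g * b = f * a at hab
    obtain ⟨c, hc⟩ : g ∣ a := hfg.symm.dvd_of_dvd_mul_left ⟨b, hab.symm⟩
    refine ⟨c, ⟨?_, by simp⟩, ?_⟩
    · by_cases hc0 : c = 0
      · simp [hc0]
      have : a.totalDegree ≤ e + r := ha.1
      rw [hc, MvPolynomial.totalDegree_mul_of_isDomain hg hc0] at this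
      omega
    · change f * g * c = f * a
      rw [hc, mul_assoc]
  have h4 := Submodule.finrank_sup_add_finrank_inf_eq ((V (e + r)).map (LinearMap.mulLeft K f))
    ((V (d + r)).map (LinearMap.mulLeft K g))
  have h5 := Submodule.finrank_mono h3
  have h6 := Submodule.finrank_mono (sup_le h1 h2)
  have h7 := finrank_vanishing_add_le m T'
  rw [hmul f hf, hmul g hg] at h4
  rw [hmul _ (mul_ne_zero hf hg)] at h5
  rw [hT'] at h7
  have hle : (e + r + 3).choose 3 + (d + r + 3).choose 3 + N * (m + 1 - N) ≤
      (m + 3).choose 3 + (r + 3).choose 3 := by omega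
  have hle' : 6 * (e + r + 3).choose 3 + 6 * (d + r + 3).choose 3 + 6 * (N * (m + 1 - N)) ≤
      6 * (m + 3).choose 3 + 6 * (r + 3).choose 3 := by omega
  simp only [six_mul_choose_three] at hle'
  obtain ⟨w, hw⟩ : ∃ w, m + 1 = w + N := ⟨d + e + N ^ 2 + 1, by omega⟩
  rw [show m + 1 - N = w by omega] at hle'
  have hw' : w = d + e + N ^ 2 + 1 := by omega
  zify at hle' hN hw' hr hm
  have id : ((m : ℤ) + 1) * (m + 2) * (m + 3) + (r + 1) * (r + 2) * (r + 3) -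
      ((e + r + 1) * (e + r + 2) * (e + r + 3) + (d + r + 1) * (d + r + 2) * (d + r + 3)) =
      3 * (d * e) * (2 * (d + e + r + 2) - d - e) := by
    rw [hm]; ring
  have hde : (d : ℤ) * e = N - 1 := by rw [hN]; ring
  rw [hde] at id
  have hN1 : (1 : ℤ) ≤ N := by rw [hN]; nlinarith [Nat.zero_le (d * e)]
  have h8 : (0 : ℤ) ≤ (N - 1) * (d + e) := mul_nonneg (by linarith) (by positivity)
  have h9 : 6 * ((N : ℤ) * w) ≤ 3 * (N - 1) * (2 * (d + e + r + 2) - d - e) := by linarith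
  rw [hw', hr] at h9
  nlinarith

end NullLine

/-- The sum `∑_{h ≤ D} (d + 1 - h)⁺`. -/
def truncSum (d D : ℕ) : ℕ := ∑ h ∈ Finset.range (D + 1), (d + 1 - h)

theorem two_mul_truncSum_le (d D : ℕ) : 2 * truncSum d D ≤ (d + 1) * (d + 2) := by
  have key : 2 * truncSum d D + (d - D) * (d + 1 - D) ≤ (d + 1) * (d + 2) := by
    induction D with
    | zero => simp only [truncSum, zero_add, Finset.sum_range_one, Nat.sub_zero]; nlinarith
    | succ D ih =>
      rw [truncSum, Finset.sum_range_succ, ← truncSum]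
      rcases Nat.lt_or_ge D d with h | h
      · obtain ⟨a, rfl⟩ : ∃ a, d = D + 1 + a := ⟨d - D - 1, by omega⟩
        rw [show D + 1 + a - D = a + 1 by omega, show D + 1 + a + 1 - D = a + 2 by omega] at ih
        rw [show D + 1 + a + 1 - (D + 1) = a + 1 by omega, show D + 1 + a - (D + 1) = a by omega]
        nlinarith
      · rw [show d + 1 - (D + 1) = 0 by omega]
        omega
  omega

/-- A weighted degree-ordering bound for finite graphs: averaging over the last vertex. -/
theorem le_sum_truncSum_div {V : Type*} (Adj : V → V → Prop) (hirr : ∀ v, ¬ Adj v v) (d : ℕ) (W : Finset V → ℝ) (S : Finset V)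
    (h0 : W ∅ ≤ 0)
    (hW : ∀ T ⊆ S, ∀ v ∈ S, v ∉ T →
      W (insert v T) ≤ W T + ((d + 1 - (T.filter (Adj v)).card : ℕ) : ℝ)) :
    W S ≤ ∑ v ∈ S, (truncSum d (S.filter (Adj v)).card : ℝ) / ((S.filter (Adj v)).card + 1) := by
  set g : ℕ → ℝ := fun D => (truncSum d D : ℝ) / (D + 1) with hg
  have hg1 : ∀ D : ℕ, ((D : ℝ) + 1) * g D = truncSum d D := fun D => by
    rw [hg]; field_simp
  change W S ≤ ∑ v ∈ S, g (S.filter (Adj v)).card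
  induction hn : S.card generalizing S with
  | zero =>
    rw [Finset.card_eq_zero] at hn
    simpa [hn] using h0
  | succ n ih =>
    have step : ∀ v ∈ S, W S ≤ ∑ u ∈ S.erase v, g ((S.erase v).filter (Adj u)).card +
        ((d + 1 - (S.filter (Adj v)).card : ℕ) : ℝ) := by
      intro v hv
      have h1 := hW (S.erase v) (Finset.erase_subset _ _) v hv (Finset.notMem_erase v S)
      rw [Finset.insert_erase hv] at h1
      have h2 := ih (S.erase v) (fun T hT u hu huT => hW T (hT.trans (Finset.erase_subset _ _)) u
        (Finset.mem_of_mem_erase hu) huT) (by rw [Finset.card_erase_of_mem hv, hn]; rfl)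
      have h3 : (S.erase v).filter (Adj v) = S.filter (Adj v) := by
        rw [Finset.filter_erase]
        exact Finset.erase_eq_of_notMem fun h => hirr v (Finset.mem_filter.mp h).2
      rw [h3] at h1
      linarith
    have hsum := Finset.sum_le_sum step
    rw [Finset.sum_const, hn, nsmul_eq_mul, Finset.sum_add_distrib] at hsum
    have hswap : ∑ v ∈ S, ∑ u ∈ S.erase v, g ((S.erase v).filter (Adj u)).card =
        ∑ u ∈ S, ∑ v ∈ S.erase u, g ((S.erase v).filter (Adj u)).card := by
      refine Finset.sum_comm' fun v u => ?_
      simp only [Finset.mem_erase]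
      tauto
    rw [hswap, ← Finset.sum_add_distrib] at hsum
    have hterm : ∀ u ∈ S, ∑ v ∈ S.erase u, g ((S.erase v).filter (Adj u)).card +
        ((d + 1 - (S.filter (Adj u)).card : ℕ) : ℝ) = (n + 1) * g (S.filter (Adj u)).card := by
      intro u hu
      set D := (S.filter (Adj u)).card with hD
      have h1 : ∀ v ∈ S.erase u, g ((S.erase v).filter (Adj u)).card =
          g D + if Adj u v then g (D - 1) - g D else 0 := by
        intro v hv
        rw [Finset.filter_erase]
        split_ifs with h
        · rw [Finset.card_erase_of_mem
            (Finset.mem_filter.mpr ⟨Finset.mem_of_mem_erase hv, h⟩)]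
          ring
        · rw [Finset.erase_eq_of_notMem fun h' => h (Finset.mem_filter.mp h').2, add_zero]
      rw [Finset.sum_congr rfl h1, Finset.sum_add_distrib, ← Finset.sum_filter, Finset.sum_const,
        Finset.sum_const, Finset.card_erase_of_mem hu, hn, Finset.filter_erase,
        Finset.erase_eq_of_notMem fun h' => hirr u (Finset.mem_filter.mp h').2, ← hD,
        nsmul_eq_mul, nsmul_eq_mul, Nat.add_sub_cancel]
      have h2 := hg1 D
      rcases Nat.eq_zero_or_pos D with h | h
      · rw [h] at h2 ⊢
        simp only [truncSum, zero_add, Finset.sum_range_one, Nat.sub_zero] at h2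
        push_cast at h2 ⊢
        linarith
      · obtain ⟨k, hk⟩ : ∃ k, D = k + 1 := ⟨D - 1, by omega⟩
        have h3 := hg1 k
        rw [hk] at h2 ⊢
        rw [truncSum, Finset.sum_range_succ, ← truncSum] at h2
        rw [Nat.add_sub_cancel]
        push_cast at h2 ⊢
        linarith
    rw [Finset.sum_congr rfl hterm, ← Finset.mul_sum] at hsum
    push_cast at hsum
    exact le_of_mul_le_mul_left hsum (by positivity)

namespace NullLine

variable {K : Type*} [Field K]

/-- Two null lines of different slopes with a common point. -/
def Adj (l m : NullLine K) : Prop := l.slope ≠ m.slope ∧ ∃ t, l.point t = m.point t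

theorem not_adj_self (l : NullLine K) : ¬ Adj l l := fun h => h.1 rfl

theorem Adj.symm {l m : NullLine K} (h : Adj l m) : Adj m l :=
  ⟨h.1.symm, h.2.imp fun _ ht => ht.symm⟩

/-- No three lines in the set meet pairwise. -/
def TriangleFree (S : Finset (NullLine K)) : Prop :=
  ∀ l ∈ S, ∀ m ∈ S, ∀ k ∈ S, Adj l m → Adj l k → ¬ Adj m k

theorem TriangleFree.mono {S T : Finset (NullLine K)} (hS : TriangleFree S) (h : T ⊆ S) :
    TriangleFree T :=
  fun l hl m hm k hk => hS l (h hl) m (h hm) k (h hk)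

/-- The parameter of the intersection point of two adjacent null lines. -/
noncomputable def meet (l m : NullLine K) : K := (m.y₀ - l.y₀) / (l.slope - m.slope)

theorem Adj.point_meet {l m : NullLine K} (h : Adj l m) :
    l.point (meet l m) = m.point (meet l m) := by
  obtain ⟨hs, t, ht⟩ := h
  have h1 : l.y₀ + l.slope * t = m.y₀ + m.slope * t := by simpa [point] using congrFun ht 1
  have h2 : l.slope - m.slope ≠ 0 := sub_ne_zero.mpr hs
  have h3 : meet l m = t := by
    rw [meet, div_eq_iff h2]
    linear_combination -h1
  rw [h3, ht]

theorem eq_of_slope_eq_of_point_eq {l m : NullLine K} (h : l.slope = m.slope) {t : K}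
    (ht : l.point t = m.point t) : l = m := by
  have h1 : l.y₀ + l.slope * t = m.y₀ + m.slope * t := by simpa [point] using congrFun ht 1
  have h2 : l.z₀ + l.slope ^ 2 * t = m.z₀ + m.slope ^ 2 * t := by
    simpa [point] using congrFun ht 2
  rw [h] at h1 h2
  exact NullLine.ext h (add_right_cancel h1) (add_right_cancel h2)

/-- The lines of `S` meeting `l`. -/
noncomputable def nbrs (S : Finset (NullLine K)) (l : NullLine K) : Finset (NullLine K) :=
  S.filter (Adj l)

theorem mem_nbrs {S : Finset (NullLine K)} {l m : NullLine K} :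
    m ∈ nbrs S l ↔ m ∈ S ∧ Adj l m := Finset.mem_filter

theorem TriangleFree.injOn_meet {S : Finset (NullLine K)} (hS : TriangleFree S) {l : NullLine K}
    (hl : l ∈ S) : Set.InjOn (meet l) (nbrs S l) := by
  intro m hm k hk hmk
  rw [Finset.mem_coe, mem_nbrs] at hm hk
  have hp : m.point (meet l m) = k.point (meet l m) := by
    rw [← hm.2.point_meet, hmk, hk.2.point_meet]
  by_contra hne
  by_cases hs : m.slope = k.slope
  · exact hne (eq_of_slope_eq_of_point_eq hs hp)
  · exact hS l hl m hm.1 k hk.1 hm.2 hk.2 ⟨hs, _, hp⟩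

/-- A triangle-free set of null lines with large degrees lies on a surface of small degree. -/
theorem exists_ne_zero_vanishing {S : Finset (NullLine K)} (hS : TriangleFree S) (Y d : ℕ)
    (hY : ∀ l ∈ S, Y ≤ (nbrs S l).card) (hd : 3 * S.card < (d + 3) * (Y + 1)) :
    ∃ f : MvPolynomial (Fin 3) K, f ≠ 0 ∧ f.totalDegree ≤ d ∧ ∀ l ∈ S, l.res f = 0 := by
  set W : Finset (NullLine K) → ℝ := fun T =>
    ((d + 3).choose 3 : ℝ) - Module.finrank K (vanishing d T) with hWdef
  have hW : W S ≤ ∑ v ∈ S, (truncSum d (S.filter (Adj v)).card : ℝ) /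
      ((S.filter (Adj v)).card + 1) := by
    refine le_sum_truncSum_div Adj not_adj_self d W S ?_ ?_
    · simp [hWdef, finrank_vanishing_empty]
    · intro T hT v hv _
      have h1 := finrank_vanishing_le_insert d T v ((nbrs T v).image (meet v)) (by
        intro t ht
        obtain ⟨m, hm, rfl⟩ := Finset.mem_image.mp ht
        rw [mem_nbrs] at hm
        exact ⟨m, hm.1, hm.2.point_meet.symm⟩)
      have hsub : nbrs T v ⊆ nbrs S v := Finset.filter_subset_filter _ hT
      rw [Finset.card_image_of_injOn ((hS.injOn_meet hv).mono (Finset.coe_subset.mpr hsub)),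
        nbrs] at h1
      have h2 : (Module.finrank K (vanishing d T) : ℝ) ≤
        Module.finrank K (vanishing d (insert v T)) +
          ((d + 1 - (T.filter (Adj v)).card : ℕ) : ℝ) := by exact_mod_cast h1
      simp only [hWdef]
      linarith
  have hterm : ∀ v ∈ S, (truncSum d (S.filter (Adj v)).card : ℝ) /
      ((S.filter (Adj v)).card + 1) ≤ ((d + 1) * (d + 2) / 2) / (Y + 1) := by
    intro v hv
    have h1 : (2 * truncSum d (S.filter (Adj v)).card : ℝ) ≤ (d + 1) * (d + 2) := by
      exact_mod_cast two_mul_truncSum_le d _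
    have h2 : (Y : ℝ) ≤ (S.filter (Adj v)).card := by exact_mod_cast hY v hv
    gcongr
    linarith
  have hle := hW.trans (Finset.sum_le_sum hterm)
  rw [Finset.sum_const, nsmul_eq_mul] at hle
  have h6 : (6 * (d + 3).choose 3 : ℝ) = (d + 1) * (d + 2) * (d + 3) := by
    exact_mod_cast six_mul_choose_three d
  have hd' : (3 * S.card : ℝ) < (d + 3) * (Y + 1) := by exact_mod_cast hd
  have hlt : (S.card : ℝ) * (((d + 1) * (d + 2) / 2) / (Y + 1)) < (d + 3).choose 3 := by
    have hY0 : (0 : ℝ) < Y + 1 := by positivity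
    rw [← mul_div_assoc, div_lt_iff₀ hY0]
    have h7 : (0 : ℝ) < (d + 1) * (d + 2) := by positivity
    nlinarith
  have hpos : 0 < Module.finrank K (vanishing d S) := by
    have : (0 : ℝ) < Module.finrank K (vanishing d S) := by
      simp only [hWdef] at hle
      linarith
    exact_mod_cast this
  obtain ⟨⟨f, hf⟩, hf0⟩ := Module.finrank_pos_iff_exists_ne_zero.mp hpos
  exact ⟨f, fun h => hf0 (Subtype.ext h), hf.1, hf.2⟩

theorem TriangleFree.res_eq_zero {S T : Finset (NullLine K)} (hS : TriangleFree S)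
    {l : NullLine K} (hl : l ∈ S) (hT : T ⊆ nbrs S l) {f : MvPolynomial (Fin 3) K}
    (hf : ∀ m ∈ T, MvPolynomial.eval (l.point (meet l m)) f = 0)
    (hcard : f.totalDegree < T.card) : l.res f = 0 := by
  refine l.res_eq_zero_of_eval_eq_zero (T.image (meet l)) (fun t ht => ?_) ?_
  · obtain ⟨m, hm, rfl⟩ := Finset.mem_image.mp ht
    exact hf m hm
  · rwa [Finset.card_image_of_injOn ((hS.injOn_meet hl).mono (Finset.coe_subset.mpr hT))]

theorem Adj.eval_point_meet {l m : NullLine K} (h : Adj l m) {f : MvPolynomial (Fin 3) K}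
    (hf : m.res f = 0) : MvPolynomial.eval (l.point (meet l m)) f = 0 := by
  rw [h.point_meet]
  exact eval_point_of_res_eq_zero hf _

theorem totalDegree_pos_of_not_isUnit {f : MvPolynomial (Fin 3) K} (hf : f ≠ 0)
    (hu : ¬ IsUnit f) : 0 < f.totalDegree := by
  rw [Nat.pos_iff_ne_zero]
  intro h
  rw [MvPolynomial.totalDegree_eq_zero_iff_eq_C] at h
  refine hu (h ▸ (IsUnit.mk0 _ fun h0 => hf ?_).map MvPolynomial.C)
  rw [h, h0, map_zero]

theorem TriangleFree.card_nbrs_le {S : Finset (NullLine K)} (hS : TriangleFree S)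
    {l : NullLine K} (hl : l ∈ S) {g h : MvPolynomial (Fin 3) K} (hlh : l.res h ≠ 0)
    (hv : ∀ m ∈ S, m.res (g * h) = 0) :
    (nbrs S l).card ≤
      (nbrs (S.filter fun m => m.res g = 0 ∧ m.res h ≠ 0) l).card + h.totalDegree := by
  have h1 : ((nbrs S l).filter fun m => m.res h = 0).card ≤ h.totalDegree := by
    by_contra! hlt
    refine hlh (hS.res_eq_zero hl (Finset.filter_subset _ _) (fun m hm => ?_) hlt)
    rw [Finset.mem_filter, mem_nbrs] at hm
    exact hm.1.2.eval_point_meet hm.2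
  have h2 : (nbrs S l).filter (fun m => ¬ m.res h = 0) ⊆
      nbrs (S.filter fun m => m.res g = 0 ∧ m.res h ≠ 0) l := by
    intro m hm
    rw [Finset.mem_filter, mem_nbrs] at hm
    rw [mem_nbrs, Finset.mem_filter]
    have h3 := hv m hm.1.1
    rw [map_mul] at h3
    exact ⟨⟨hm.1.1, (mul_eq_zero.mp h3).resolve_right hm.2, hm.2⟩, hm.1.2⟩
  have h3 := Finset.card_le_card h2
  have h4 := Finset.card_filter_add_card_filter_not (s := nbrs S l) (fun m => m.res h = 0)
  omega

theorem exists_irreducible_vanishing (X : ℕ) (f : MvPolynomial (Fin 3) K)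
    (S : Finset (NullLine K)) (hf : f ≠ 0)
    (hS : TriangleFree S) (hne : S.Nonempty) (hcard : 4 * f.totalDegree ^ 2 ≤ S.card)
    (hX : ∀ l ∈ S, X + 4 * f.totalDegree ≤ (nbrs S l).card) (hv : ∀ l ∈ S, l.res f = 0) :
    ∃ g : MvPolynomial (Fin 3) K, ∃ S' ⊆ S, Irreducible g ∧ g.totalDegree ≤ f.totalDegree ∧
      S'.Nonempty ∧ 4 * g.totalDegree ^ 2 ≤ S'.card ∧
      (∀ l ∈ S', X + 4 * g.totalDegree ≤ (nbrs S' l).card) ∧ ∀ l ∈ S', l.res g = 0 := by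
  induction hd : f.totalDegree using Nat.strong_induction_on generalizing f S with
  | _ d ih =>
    subst hd
    by_cases hirr : Irreducible f
    · exact ⟨f, S, subset_rfl, hirr, le_rfl, hne, hcard, hX, hv⟩
    have hu : ¬ IsUnit f := by
      obtain ⟨l, hl⟩ := hne
      exact fun hu => (hu.map l.res).ne_zero (hv l hl)
    rw [irreducible_iff] at hirr
    push Not at hirr
    obtain ⟨g, h, rfl, hgu, hhu⟩ := hirr hu
    have hg0 : g ≠ 0 := left_ne_zero_of_mul hf
    have hh0 : h ≠ 0 := right_ne_zero_of_mul hf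
    have hgd := totalDegree_pos_of_not_isUnit hg0 hgu
    have hhd := totalDegree_pos_of_not_isUnit hh0 hhu
    have hdeg := MvPolynomial.totalDegree_mul_of_isDomain hg0 hh0
    by_cases hrel : IsRelPrime g h
    · have main : ∀ g' h' : MvPolynomial (Fin 3) K, g' ≠ 0 → 0 < g'.totalDegree →
          g'.totalDegree + h'.totalDegree = (g * h).totalDegree → 0 < h'.totalDegree →
          (∀ l ∈ S, l.res (g' * h') = 0) →
          4 * g'.totalDegree ^ 2 ≤ (S.filter fun m => m.res g' = 0 ∧ m.res h' ≠ 0).card →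
          ∃ k : MvPolynomial (Fin 3) K, ∃ S' ⊆ S, Irreducible k ∧
            k.totalDegree ≤ (g * h).totalDegree ∧
            S'.Nonempty ∧ 4 * k.totalDegree ^ 2 ≤ S'.card ∧
            (∀ l ∈ S', X + 4 * k.totalDegree ≤ (nbrs S' l).card) ∧ ∀ l ∈ S', l.res k = 0 := by
        intro g' h' hg0' hgd' hdd hhd' hv' hc'
        have hsub := Finset.filter_subset (fun m => m.res g' = 0 ∧ m.res h' ≠ 0) S
        obtain ⟨k, S', h1', h2', h3', h4'⟩ := ih _ (by omega) g'
          (S.filter fun m => m.res g' = 0 ∧ m.res h' ≠ 0) hg0' (hS.mono hsub)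
          (Finset.card_pos.mp (by nlinarith)) hc' (fun l hl => by
            rw [Finset.mem_filter] at hl
            have := hS.card_nbrs_le hl.1 hl.2.2 hv'
            have := hX l hl.1
            omega) (fun l hl => (Finset.mem_filter.mp hl).2.1) rfl
        exact ⟨k, S', h1'.trans hsub, h2', h3'.trans (by omega), h4'⟩
      have hboth := card_le_of_isRelPrime hg0 hh0 hrel
        (S.filter fun m => m.res g = 0 ∧ m.res h = 0) fun l hl => (Finset.mem_filter.mp hl).2
      have hcover : S ⊆ ((S.filter fun m => m.res g = 0 ∧ m.res h ≠ 0) ∪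
          (S.filter fun m => m.res h = 0 ∧ m.res g ≠ 0)) ∪
          (S.filter fun m => m.res g = 0 ∧ m.res h = 0) := by
        intro l hl
        have := hv l hl
        rw [map_mul, mul_eq_zero] at this
        simp only [Finset.mem_union, Finset.mem_filter]
        tauto
      have hc := (Finset.card_le_card hcover).trans (Finset.card_union_le _ _)
      have hc2 := Finset.card_union_le (S.filter fun m => m.res g = 0 ∧ m.res h ≠ 0)
        (S.filter fun m => m.res h = 0 ∧ m.res g ≠ 0)
      by_cases hcg : 4 * g.totalDegree ^ 2 ≤
          (S.filter fun m => m.res g = 0 ∧ m.res h ≠ 0).card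
      · exact main g h hg0 hgd hdeg.symm hhd hv hcg
      · refine main h g hh0 hhd (by omega) hgd (fun l hl => by rw [mul_comm]; exact hv l hl) ?_
        rw [hdeg] at hcard
        nlinarith
    · rw [IsRelPrime] at hrel
      push Not at hrel
      obtain ⟨e, ⟨g1, rfl⟩, ⟨h1, rfl⟩, heu⟩ := hrel
      have he0 : e ≠ 0 := left_ne_zero_of_mul hg0
      have hg10 : g1 ≠ 0 := right_ne_zero_of_mul hg0
      have hh10 : h1 ≠ 0 := right_ne_zero_of_mul hh0
      have hed := totalDegree_pos_of_not_isUnit he0 heu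
      have hprod : e * g1 * h1 ≠ 0 := mul_ne_zero hg0 hh10
      have hdeg' : (e * g1 * h1).totalDegree < (e * g1 * (e * h1)).totalDegree := by
        rw [hdeg, MvPolynomial.totalDegree_mul_of_isDomain hg0 hh10,
          MvPolynomial.totalDegree_mul_of_isDomain he0 hh10]
        omega
      obtain ⟨k, S', h1', h2', h3', h4'⟩ := ih _ hdeg' (e * g1 * h1) S hprod hS hne
        (le_trans (by gcongr) hcard) (fun l hl => le_trans (by gcongr) (hX l hl)) (fun l hl => by
          have := hv l hl
          simp only [map_mul, mul_eq_zero] at this ⊢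
          tauto) rfl
      exact ⟨k, S', h1', h2', h3'.trans hdeg'.le, h4'⟩

end NullLine

/-- A second-order linear differential equation with leading coefficient nonzero at `t₀` forces
polynomial solutions with vanishing initial values to vanish, in large characteristic. -/
theorem Polynomial.eq_zero_of_second_order_ode {K : Type*} [Field K] {G a u v : Polynomial K}
    {t₀ : K} (hchar : ∀ k : ℕ, 1 ≤ k → k ≤ G.natDegree → (k : K) ≠ 0) (ha : a.eval t₀ ≠ 0)
    (h0 : G.eval t₀ = 0) (h1 : (derivative G).eval t₀ = 0)
    (hode : a * derivative (derivative G) = u * derivative G + v * G) : G = 0 := by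
  by_contra hG
  obtain ⟨g, hg, hndvd⟩ := G.exists_eq_pow_rootMultiplicity_mul_and_not_dvd hG t₀
  have hg0 : g.eval t₀ ≠ 0 := fun h => hndvd (Polynomial.dvd_iff_isRoot.mpr h)
  have hn : G.rootMultiplicity t₀ ≤ G.natDegree :=
    (Polynomial.count_roots G (a := t₀)) ▸ (Multiset.count_le_card _ _).trans
      (Polynomial.card_roots' G)
  set n := G.rootMultiplicity t₀ with hndef
  have hXd : derivative (Polynomial.X - Polynomial.C t₀) = 1 := by
    rw [Polynomial.derivative_sub, Polynomial.derivative_X, Polynomial.derivative_C, sub_zero]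
  set L : Polynomial K := Polynomial.X - Polynomial.C t₀ with hL
  have hL0 : L ≠ 0 := Polynomial.X_sub_C_ne_zero t₀
  have hLe : L.eval t₀ = 0 := by simp [hL]
  match n with
  | 0 =>
    rw [hg] at h0
    simp at h0
    exact hg0 h0
  | 1 =>
    rw [hg, pow_one, Polynomial.derivative_mul, hXd] at h1
    simp [hLe] at h1
    exact hg0 h1
  | k + 2 =>
    have hd1 : derivative G = L ^ (k + 1) * (Polynomial.C ((k + 2 : ℕ) : K) * g +
        L * derivative g) := by
      rw [hg, Polynomial.derivative_mul, Polynomial.derivative_pow, hXd]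
      simp only [show k + 2 - 1 = k + 1 by omega]
      ring
    have hd2 : derivative (derivative G) = L ^ k * (Polynomial.C ((k + 1 : ℕ) : K) *
        (Polynomial.C ((k + 2 : ℕ) : K) * g + L * derivative g) + L *
        derivative (Polynomial.C ((k + 2 : ℕ) : K) * g + L * derivative g)) := by
      rw [hd1, Polynomial.derivative_mul, Polynomial.derivative_pow, hXd]
      simp only [Nat.add_sub_cancel]
      ring
    have hcancel : a * (Polynomial.C ((k + 1 : ℕ) : K) *
        (Polynomial.C ((k + 2 : ℕ) : K) * g + L * derivative g) + L *
        derivative (Polynomial.C ((k + 2 : ℕ) : K) * g + L * derivative g)) =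
        u * (L * (Polynomial.C ((k + 2 : ℕ) : K) * g + L * derivative g)) + v * (L ^ 2 * g) := by
      refine mul_left_cancel₀ (pow_ne_zero k hL0) ?_
      rw [hd2, hd1] at hode
      linear_combination hode + v * hg
    have he := congrArg (Polynomial.eval t₀) hcancel
    simp only [Polynomial.eval_mul, Polynomial.eval_add, hLe, Polynomial.eval_C, zero_mul,
      mul_zero, add_zero, Polynomial.eval_pow, ne_eq, OfNat.ofNat_ne_zero, not_false_eq_true,
      zero_pow] at he
    have hk1 := hchar (k + 1) (by omega) (by omega)
    have hk2 := hchar (k + 2) (by omega) (by omega)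
    exact mul_ne_zero ha (mul_ne_zero hk1 (mul_ne_zero hk2 hg0)) he

namespace MvPolynomial

variable {σ R : Type*} [CommRing R]

theorem totalDegree_add_le_of_le {f g : MvPolynomial σ R} {n : ℕ} (hf : f.totalDegree ≤ n)
    (hg : g.totalDegree ≤ n) : (f + g).totalDegree ≤ n :=
  (totalDegree_add f g).trans (max_le hf hg)

theorem totalDegree_sub_le_of_le {f g : MvPolynomial σ R} {n : ℕ} (hf : f.totalDegree ≤ n)
    (hg : g.totalDegree ≤ n) : (f - g).totalDegree ≤ n :=
  (totalDegree_sub f g).trans (max_le hf hg)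

theorem totalDegree_mul_le_of_le {f g : MvPolynomial σ R} {m n k : ℕ} (hf : f.totalDegree ≤ m)
    (hg : g.totalDegree ≤ n) (h : m + n ≤ k) : (f * g).totalDegree ≤ k :=
  (totalDegree_mul f g).trans ((add_le_add hf hg).trans h)

theorem totalDegree_mul₄_le {f g h k : MvPolynomial σ R} {n : ℕ} (hf : f.totalDegree ≤ n)
    (hg : g.totalDegree ≤ n) (hh : h.totalDegree ≤ n) (hk : k.totalDegree ≤ n) :
    (f * g * h * k).totalDegree ≤ 4 * n :=
  totalDegree_mul_le_of_le (totalDegree_mul_le_of_le (totalDegree_mul_le_of_le hf hg le_rfl) hh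
    le_rfl) hk (by omega)

theorem exists_pderiv_ne_zero {K : Type*} [Field K] {f : MvPolynomial σ K}
    (hchar : ∀ k : ℕ, 1 ≤ k → k ≤ f.totalDegree → (k : K) ≠ 0) (hf : 0 < f.totalDegree) :
    ∃ i, pderiv i f ≠ 0 := by
  obtain ⟨n, hn, i, hi⟩ : ∃ n ∈ f.support, ∃ i, n i ≠ 0 := by
    by_contra! hcon
    refine hf.ne' (Nat.le_zero.mp (Finset.sup_le fun n hn => ?_))
    rw [show n = 0 from Finsupp.ext (hcon n hn)]
    simp
  refine ⟨i, fun h => ?_⟩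
  have hni : Finsupp.single i 1 ≤ n := by simpa using Nat.one_le_iff_ne_zero.mpr hi
  have hc := congrArg (coeff (n - Finsupp.single i 1)) h
  rw [coeff_pderiv, tsub_add_cancel_of_le hni, coeff_zero, mul_eq_zero] at hc
  refine hc.elim (mem_support_iff.mp hn) fun h' => ?_
  have hle : n i ≤ f.totalDegree :=
    le_trans (Finset.single_le_sum (f := n) (fun _ _ => Nat.zero_le _)
      (Finsupp.mem_support_iff.mpr hi)) (le_totalDegree hn)
  refine hchar (n i) (Nat.one_le_iff_ne_zero.mpr hi) hle ?_
  rw [← h']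
  obtain ⟨k, hk⟩ := Nat.exists_eq_succ_of_ne_zero hi
  simp [hk]

end MvPolynomial

namespace NullLine

variable {K : Type*} [Field K]

theorem dvd_of_res_eq_zero {f g : MvPolynomial (Fin 3) K} (hf : Irreducible f)
    (T : Finset (NullLine K)) (hT : ∀ l ∈ T, l.res f = 0 ∧ l.res g = 0)
    (hcard : f.totalDegree * g.totalDegree < T.card) : f ∣ g := by
  by_contra hdvd
  exact absurd (card_le_of_isRelPrime hf.ne_zero (fun h => hdvd (by rw [h]; exact dvd_zero f))
    (hf.isRelPrime_iff_not_dvd.mpr hdvd) T hT) (not_le.mpr hcard)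

theorem dvd_of_infinite_res_eq_zero {f g : MvPolynomial (Fin 3) K} (hf : Irreducible f)
    (h : {l : NullLine K | l.res f = 0 ∧ l.res g = 0}.Infinite) : f ∣ g := by
  obtain ⟨T, hT, hc⟩ := h.exists_subset_card_eq (f.totalDegree * g.totalDegree + 1)
  exact dvd_of_res_eq_zero hf T (fun l hl => hT hl) (by omega)

/-- The pieces `h₀, …, h₄` of the second derivative along `(1, s, s²)`. -/
noncomputable def hessCoeff (f : MvPolynomial (Fin 3) K) : Fin 5 → MvPolynomial (Fin 3) K :=
  ![pderiv 0 (pderiv 0 f), pderiv 0 (pderiv 1 f) + pderiv 1 (pderiv 0 f),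
    pderiv 0 (pderiv 2 f) + pderiv 2 (pderiv 0 f) + pderiv 1 (pderiv 1 f),
    pderiv 1 (pderiv 2 f) + pderiv 2 (pderiv 1 f), pderiv 2 (pderiv 2 f)]

theorem nullDeriv_nullDeriv (s : K) (f : MvPolynomial (Fin 3) K) :
    nullDeriv s (nullDeriv s f) = hessCoeff f 0 + MvPolynomial.C s * hessCoeff f 1 +
      MvPolynomial.C (s ^ 2) * hessCoeff f 2 + MvPolynomial.C (s ^ 3) * hessCoeff f 3 +
      MvPolynomial.C (s ^ 4) * hessCoeff f 4 := by
  simp only [nullDeriv, map_add, MvPolynomial.pderiv_C_mul, map_pow, hessCoeff]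
  simp
  ring

theorem totalDegree_hessCoeff_le (f : MvPolynomial (Fin 3) K) (i : Fin 5) :
    (hessCoeff f i).totalDegree ≤ f.totalDegree - 1 := by
  have h : ∀ i j, (pderiv i (pderiv j f)).totalDegree ≤ f.totalDegree - 1 := fun i j =>
    (totalDegree_pderiv_le _ _).trans (by have := totalDegree_pderiv_le j f; omega)
  fin_cases i
  · exact h _ _
  · exact MvPolynomial.totalDegree_add_le_of_le (h _ _) (h _ _)
  · exact MvPolynomial.totalDegree_add_le_of_le
      (MvPolynomial.totalDegree_add_le_of_le (h _ _) (h _ _)) (h _ _)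
  · exact MvPolynomial.totalDegree_add_le_of_le (h _ _) (h _ _)
  · exact h _ _

section Flecnode

variable {R : Type*} [CommRing R]

/-- Linear coefficient of the remainder of `A³(h₀ + h₁ s + … + h₄ s⁴)` modulo
`C + B s + A s²`. -/
def remOne (A B C h₁ h₂ h₃ h₄ : R) : R :=
  A * B * C * h₄ + A * B * C * h₄ - B * B * B * h₄ + A * B * B * h₃ - A * A * C * h₃ -
    A * A * B * h₂ + A * A * A * h₁

/-- Constant coefficient of the remainder of `A³(h₀ + h₁ s + … + h₄ s⁴)` modulo
`C + B s + A s²`. -/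
def remZero (A B C h₀ h₂ h₃ h₄ : R) : R :=
  A * C * C * h₄ - B * B * C * h₄ + A * B * C * h₃ - A * A * C * h₂ + A * A * A * h₀

theorem rem_identity (A B C h₀ h₁ h₂ h₃ h₄ s : R) :
    A ^ 3 * (h₀ + s * h₁ + s ^ 2 * h₂ + s ^ 3 * h₃ + s ^ 4 * h₄) =
      remOne A B C h₁ h₂ h₃ h₄ * s + remZero A B C h₀ h₂ h₃ h₄ + (C + s * B + s ^ 2 * A) *
        (h₄ * A ^ 2 * s ^ 2 + (h₃ * A ^ 2 - h₄ * A * B) * s +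
          (h₂ * A ^ 2 - h₄ * A * C - h₃ * A * B + h₄ * B ^ 2)) := by
  rw [remOne, remZero]; ring

end Flecnode

/-- First flecnode polynomial. -/
noncomputable def flecOne (f : MvPolynomial (Fin 3) K) : MvPolynomial (Fin 3) K :=
  remOne (pderiv 2 f) (pderiv 1 f) (pderiv 0 f) (hessCoeff f 1) (hessCoeff f 2) (hessCoeff f 3)
    (hessCoeff f 4)

/-- Second flecnode polynomial. -/
noncomputable def flecZero (f : MvPolynomial (Fin 3) K) : MvPolynomial (Fin 3) K :=
  remZero (pderiv 2 f) (pderiv 1 f) (pderiv 0 f) (hessCoeff f 0) (hessCoeff f 2) (hessCoeff f 3)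
    (hessCoeff f 4)

theorem totalDegree_flecOne_le (f : MvPolynomial (Fin 3) K) :
    (flecOne f).totalDegree ≤ 4 * (f.totalDegree - 1) := by
  have hp := fun i => totalDegree_pderiv_le i f
  have hh := totalDegree_hessCoeff_le f
  refine MvPolynomial.totalDegree_add_le_of_le (MvPolynomial.totalDegree_sub_le_of_le
    (MvPolynomial.totalDegree_sub_le_of_le (MvPolynomial.totalDegree_add_le_of_le
    (MvPolynomial.totalDegree_sub_le_of_le (MvPolynomial.totalDegree_add_le_of_le
    ?_ ?_) ?_) ?_) ?_) ?_) ?_ <;>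
  exact MvPolynomial.totalDegree_mul₄_le (hp _) (hp _) (hp _) (hh _)

theorem totalDegree_flecZero_le (f : MvPolynomial (Fin 3) K) :
    (flecZero f).totalDegree ≤ 4 * (f.totalDegree - 1) := by
  have hp := fun i => totalDegree_pderiv_le i f
  have hh := totalDegree_hessCoeff_le f
  refine MvPolynomial.totalDegree_add_le_of_le (MvPolynomial.totalDegree_sub_le_of_le
    (MvPolynomial.totalDegree_add_le_of_le (MvPolynomial.totalDegree_sub_le_of_le
    ?_ ?_) ?_) ?_) ?_ <;>
  exact MvPolynomial.totalDegree_mul₄_le (hp _) (hp _) (hp _) (hh _)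

theorem nullDeriv_identity (s : K) (f : MvPolynomial (Fin 3) K) :
    ∃ Q : MvPolynomial (Fin 3) K, pderiv 2 f ^ 3 * nullDeriv s (nullDeriv s f) =
      flecOne f * MvPolynomial.C s + flecZero f + nullDeriv s f * Q := by
  have h := rem_identity (pderiv 2 f) (pderiv 1 f) (pderiv 0 f) (hessCoeff f 0) (hessCoeff f 1)
    (hessCoeff f 2) (hessCoeff f 3) (hessCoeff f 4) (MvPolynomial.C s)
  simp only [← map_pow] at h
  rw [← nullDeriv_nullDeriv] at h
  exact ⟨_, h⟩

theorem res_nullDeriv_eq_zero {l : NullLine K} {f : MvPolynomial (Fin 3) K}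
    (h : l.res f = 0) : l.res (nullDeriv l.slope f) = 0 := by
  rw [← derivative_res, h, Polynomial.derivative_zero]

theorem Adj.eval_flec {l m : NullLine K} (h : Adj l m) {f : MvPolynomial (Fin 3) K}
    (hl : l.res f = 0) (hm : m.res f = 0) :
    MvPolynomial.eval (l.point (meet l m)) (flecOne f) = 0 ∧
      MvPolynomial.eval (l.point (meet l m)) (flecZero f) = 0 := by
  set P := l.point (meet l m) with hP
  have key : ∀ n : NullLine K, n.res f = 0 → n.point (meet l m) = P →
      MvPolynomial.eval P (flecOne f) * n.slope + MvPolynomial.eval P (flecZero f) = 0 := by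
    intro n hn hnP
    obtain ⟨Q, hQ⟩ := nullDeriv_identity n.slope f
    have h1 := eval_point_of_res_eq_zero (res_nullDeriv_eq_zero hn) (meet l m)
    have h2 := eval_point_of_res_eq_zero (res_nullDeriv_eq_zero (res_nullDeriv_eq_zero hn))
      (meet l m)
    rw [hnP] at h1 h2
    have h3 := congrArg (MvPolynomial.eval P) hQ
    simp only [map_mul, map_add, h1, h2, MvPolynomial.eval_C] at h3
    linear_combination -h3
  have hl' := key l hl rfl
  have hm' := key m hm h.point_meet.symm
  have h1 : MvPolynomial.eval P (flecOne f) = 0 :=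
    (mul_eq_zero.mp (by linear_combination hl' - hm' :
      MvPolynomial.eval P (flecOne f) * (l.slope - m.slope) = 0)).resolve_right
        (sub_ne_zero.mpr h.1)
  rw [h1, zero_mul, zero_add] at hl'
  exact ⟨h1, hl'⟩

theorem TriangleFree.dvd_flec {S : Finset (NullLine K)} (hS : TriangleFree S)
    {f : MvPolynomial (Fin 3) K} (hf : Irreducible f)
    (hcard : 4 * f.totalDegree ^ 2 ≤ S.card)
    (hdeg : ∀ l ∈ S, 4 * f.totalDegree ≤ (nbrs S l).card) (hv : ∀ l ∈ S, l.res f = 0) :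
    f ∣ flecOne f ∧ f ∣ flecZero f := by
  have hpos := totalDegree_pos_of_not_isUnit hf.ne_zero hf.not_isUnit
  have key : ∀ g : MvPolynomial (Fin 3) K, g.totalDegree ≤ 4 * (f.totalDegree - 1) →
      (∀ l ∈ S, ∀ m ∈ nbrs S l, MvPolynomial.eval (l.point (meet l m)) g = 0) → f ∣ g := by
    intro g hg he
    refine dvd_of_res_eq_zero hf S (fun l hl => ⟨hv l hl, ?_⟩) ?_
    · exact hS.res_eq_zero hl subset_rfl (he l hl) (by have := hdeg l hl; omega)
    · calc f.totalDegree * g.totalDegree ≤ f.totalDegree * (4 * (f.totalDegree - 1)) := by gcongr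
        _ < f.totalDegree * (4 * f.totalDegree) := by gcongr; omega
        _ ≤ S.card := by linarith
  have he : ∀ l ∈ S, ∀ m ∈ nbrs S l, _ := fun l hl m hm =>
    (mem_nbrs.mp hm).2.eval_flec (hv l hl) (hv m (mem_nbrs.mp hm).1)
  exact ⟨key _ (totalDegree_flecOne_le f) fun l hl m hm => (he l hl m hm).1,
    key _ (totalDegree_flecZero_le f) fun l hl m hm => (he l hl m hm).2⟩

/-- The null line of slope `s` through the point `P`. -/
def through (P : Fin 3 → K) (s : K) : NullLine K := ⟨s, P 1 - s * P 0, P 2 - s ^ 2 * P 0⟩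

theorem point_through (P : Fin 3 → K) (s : K) : (through P s).point (P 0) = P := by
  ext i
  fin_cases i <;> simp [point, through]

theorem eval_nullDeriv (P : Fin 3 → K) (s : K) (f : MvPolynomial (Fin 3) K) :
    MvPolynomial.eval P (nullDeriv s f) = MvPolynomial.eval P (pderiv 0 f) +
      s * MvPolynomial.eval P (pderiv 1 f) + s ^ 2 * MvPolynomial.eval P (pderiv 2 f) := by
  simp [nullDeriv]

/-- A surface satisfying the flecnode conditions contains the null lines tangent to it. -/
theorem res_through_eq_zero {f : MvPolynomial (Fin 3) K}
    (hchar : ∀ k : ℕ, 1 ≤ k → k ≤ f.totalDegree → (k : K) ≠ 0)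
    (h1 : f ∣ flecOne f) (h0 : f ∣ flecZero f) {P : Fin 3 → K} {s : K}
    (hP : MvPolynomial.eval P f = 0) (hz : MvPolynomial.eval P (pderiv 2 f) ≠ 0)
    (hs : MvPolynomial.eval P (nullDeriv s f) = 0) : (through P s).res f = 0 := by
  obtain ⟨Q, hQ⟩ := nullDeriv_identity s f
  obtain ⟨k1, hk1⟩ := h1
  obtain ⟨k0, hk0⟩ := h0
  set l := through P s with hl
  have hls : l.slope = s := rfl
  have hlP : l.point (P 0) = P := point_through P s
  refine Polynomial.eq_zero_of_second_order_ode (t₀ := P 0) (a := l.res (pderiv 2 f) ^ 3)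
    (u := l.res Q) (v := l.res (k1 * MvPolynomial.C s + k0))
    (fun k hk hk' => hchar k hk (hk'.trans (l.natDegree_res_le f))) ?_ ?_ ?_ ?_
  · rw [Polynomial.eval_pow, eval_res, hlP]
    exact pow_ne_zero 3 hz
  · rw [eval_res, hlP, hP]
  · rw [derivative_res, eval_res, hlP, hls, hs]
  · rw [derivative_res, derivative_res, hls, ← map_pow, ← map_mul, hQ, hk1, hk0]
    simp only [map_add, map_mul]
    ring

theorem finite_roots_res {l : NullLine K} {g : MvPolynomial (Fin 3) K} (hg : l.res g ≠ 0) :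
    {t : K | MvPolynomial.eval (l.point t) g = 0}.Finite := by
  refine ((l.res g).roots.toFinset.finite_toSet).subset fun t ht => ?_
  rw [Finset.mem_coe, Multiset.mem_toFinset, Polynomial.mem_roots hg, Polynomial.IsRoot, eval_res]
  exact ht

/-- Through every null line on which the surface is not too degenerate there are infinitely many
adjacent null lines in the surface. -/
theorem infinite_adj [Infinite K] {f : MvPolynomial (Fin 3) K}
    (hchar : ∀ k : ℕ, 1 ≤ k → k ≤ f.totalDegree → (k : K) ≠ 0)
    (h1 : f ∣ flecOne f) (h0 : f ∣ flecZero f) {m : NullLine K} (hm : m.res f = 0)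
    (hz : m.res (pderiv 2 f) ≠ 0)
    (hy : m.res (pderiv 1 f + MvPolynomial.C (2 * m.slope) * pderiv 2 f) ≠ 0) :
    {n : NullLine K | n.res f = 0 ∧ Adj n m}.Infinite := by
  set g := pderiv 1 f + MvPolynomial.C (2 * m.slope) * pderiv 2 f with hg
  set A : K → K := fun t => MvPolynomial.eval (m.point t) (pderiv 2 f) with hA
  set B : K → K := fun t => MvPolynomial.eval (m.point t) (pderiv 1 f) with hB
  have hinf : ({t : K | MvPolynomial.eval (m.point t) (pderiv 2 f) = 0} ∪
      {t : K | MvPolynomial.eval (m.point t) g = 0})ᶜ.Infinite :=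
    ((finite_roots_res hz).union (finite_roots_res hy)).infinite_compl
  have hgood : ∀ t ∈ ({t : K | MvPolynomial.eval (m.point t) (pderiv 2 f) = 0} ∪
      {t : K | MvPolynomial.eval (m.point t) g = 0})ᶜ, A t ≠ 0 ∧
        -B t / A t - m.slope ≠ m.slope := by
    intro t ht
    simp only [Set.mem_compl_iff, Set.mem_union, Set.mem_ofPred_eq, not_or] at ht
    refine ⟨ht.1, fun h => ht.2 ?_⟩
    have hA0 : A t ≠ 0 := ht.1
    rw [hg, map_add, map_mul, MvPolynomial.eval_C]
    change B t + 2 * m.slope * A t = 0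
    field_simp at h
    linear_combination -h
  refine (hinf.image (f := fun t => through (m.point t) (-B t / A t - m.slope)) ?_).mono ?_
  · intro t ht u hu htu
    simp only at htu
    have hslope : -B t / A t - m.slope = -B u / A u - m.slope := congrArg slope htu
    have h3 : (-B t / A t - m.slope - m.slope) * (t - u) = 0 := by
      have hy' : m.y₀ + m.slope * t - (-B t / A t - m.slope) * t =
          m.y₀ + m.slope * u - (-B u / A u - m.slope) * u := congrArg y₀ htu
      rw [← hslope] at hy'
      linear_combination -hy'
    exact sub_eq_zero.mp ((mul_eq_zero.mp h3).resolve_left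
      (sub_ne_zero.mpr (hgood t ht).2))
  · rintro _ ⟨t, ht, rfl⟩
    obtain ⟨hA0, hne⟩ := hgood t ht
    refine ⟨res_through_eq_zero hchar h1 h0 (eval_point_of_res_eq_zero hm t) hA0 ?_, hne, t, ?_⟩
    · have h2 := eval_point_of_res_eq_zero (res_nullDeriv_eq_zero hm) t
      rw [eval_nullDeriv] at h2 ⊢
      change _ + _ * B t + _ * A t = 0 at h2
      change _ + _ * B t + _ * A t = 0
      have h4 : (-B t / A t) * A t = -B t := div_mul_cancel₀ _ hA0
      linear_combination h2 + (-B t / A t - 2 * m.slope) * h4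
    · exact point_through (m.point t) (-B t / A t - m.slope)

/-- First incidence form of a null line. -/
noncomputable def incB (m : NullLine K) : MvPolynomial (Fin 3) K :=
  MvPolynomial.X 1 - MvPolynomial.C m.slope * MvPolynomial.X 0 - MvPolynomial.C m.y₀

/-- Second incidence form of a null line. -/
noncomputable def incA (m : NullLine K) : MvPolynomial (Fin 3) K :=
  MvPolynomial.X 2 - MvPolynomial.C m.slope * MvPolynomial.X 1 -
    MvPolynomial.C (m.z₀ - m.slope * m.y₀)

theorem totalDegree_X_sub_le (i j : Fin 3) (a b : K) :
    (MvPolynomial.X i - MvPolynomial.C a * MvPolynomial.X j - MvPolynomial.C b :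
      MvPolynomial (Fin 3) K).totalDegree ≤ 1 := by
  refine (MvPolynomial.totalDegree_sub_C_le _ _).trans
    (MvPolynomial.totalDegree_sub_le_of_le (MvPolynomial.totalDegree_X i).le ?_)
  refine (MvPolynomial.totalDegree_mul _ _).trans ?_
  rw [MvPolynomial.totalDegree_C, zero_add, MvPolynomial.totalDegree_X]

/-- Restriction to an adjacent null line turns `incA` into `slope * incB`. -/
theorem Adj.res_incA {n m : NullLine K} (h : Adj n m) :
    n.res (incA m) = Polynomial.C n.slope * n.res (incB m) := by
  obtain ⟨hs, t, ht⟩ := h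
  have h1 : n.y₀ + n.slope * t = m.y₀ + m.slope * t := by simpa [point] using congrFun ht 1
  have h2 : n.z₀ + n.slope ^ 2 * t = m.z₀ + m.slope ^ 2 * t := by
    simpa [point] using congrFun ht 2
  have h3 : n.z₀ - (m.z₀ - m.slope * m.y₀) - m.slope * n.y₀ = n.slope * (n.y₀ - m.y₀) := by
    linear_combination h2 - (m.slope + n.slope) * h1
  have h4 := congrArg (Polynomial.C : K → Polynomial K) h3
  simp only [incA, incB, map_sub, map_mul, res_C, res_X_zero, res_X_one, res_X_two, map_pow]
    at h4 ⊢
  linear_combination h4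

/-- The equation satisfied on all null lines in the surface which meet `m`. -/
noncomputable def incForm (f : MvPolynomial (Fin 3) K) (m : NullLine K) :
    MvPolynomial (Fin 3) K :=
  pderiv 0 f * incB m ^ 2 + pderiv 1 f * incA m * incB m + pderiv 2 f * incA m ^ 2

theorem Adj.res_incForm {n m : NullLine K} (h : Adj n m) {f : MvPolynomial (Fin 3) K}
    (hf : n.res f = 0) : n.res (incForm f m) = 0 := by
  have h1 := res_nullDeriv_eq_zero hf
  simp only [nullDeriv, incForm, map_add, map_mul, map_pow, h.res_incA, res_C] at h1 ⊢
  linear_combination n.res (incB m) ^ 2 * h1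

theorem incForm_identity (f : MvPolynomial (Fin 3) K) (m₁ m₂ m₃ : NullLine K) :
    pderiv 2 f * ((incB m₁ * incA m₂ - incA m₁ * incB m₂) *
      (incB m₁ * incA m₃ - incA m₁ * incB m₃) * (incB m₂ * incA m₃ - incA m₂ * incB m₃)) =
    incForm f m₁ * (incB m₂ * incB m₃ * (incB m₂ * incA m₃ - incA m₂ * incB m₃)) -
    incForm f m₂ * (incB m₁ * incB m₃ * (incB m₁ * incA m₃ - incA m₁ * incB m₃)) +
    incForm f m₃ * (incB m₁ * incB m₂ * (incB m₁ * incA m₂ - incA m₁ * incB m₂)) := by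
  simp only [incForm]
  ring

theorem incB_mul_incA_sub_ne_zero {m₁ m₂ : NullLine K} (h : m₁ ≠ m₂) :
    incB m₁ * incA m₂ - incA m₁ * incB m₂ ≠ 0 := by
  intro h0
  have he := fun x y z : K => congrArg (MvPolynomial.eval ![x, y, z]) h0
  simp only [incA, incB, map_sub, map_mul, MvPolynomial.eval_C, MvPolynomial.eval_X,
    Matrix.cons_val_zero, Matrix.cons_val_one, Matrix.cons_val, map_zero] at he
  have hα : m₁.y₀ = m₂.y₀ := by linear_combination he 0 0 0 - he 0 0 1
  have hs : m₁.slope = m₂.slope := by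
    linear_combination (he 0 0 1 - he 0 0 0 - he 1 0 1 + he 1 0 0)
  have hz : m₁.z₀ = m₂.z₀ := by
    have h1 := he 0 1 0
    have h2 := he 0 0 0
    rw [hα, hs] at h1 h2
    linear_combination h1 - h2
  exact h (NullLine.ext hs hα hz)

theorem totalDegree_incB_mul_incA_sub_le (m₁ m₂ : NullLine K) :
    (incB m₁ * incA m₂ - incA m₁ * incB m₂).totalDegree ≤ 2 :=
  MvPolynomial.totalDegree_sub_le_of_le
    (MvPolynomial.totalDegree_mul_le_of_le (totalDegree_X_sub_le _ _ _ _)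
      (totalDegree_X_sub_le _ _ _ _) le_rfl)
    (MvPolynomial.totalDegree_mul_le_of_le (totalDegree_X_sub_le _ _ _ _)
      (totalDegree_X_sub_le _ _ _ _) le_rfl)

/-- Lines along which the surface is singular. -/
def Singular (f : MvPolynomial (Fin 3) K) (m : NullLine K) : Prop :=
  ∀ i, m.res (pderiv i f) = 0

theorem card_singular_le {f : MvPolynomial (Fin 3) K} (hf : Irreducible f)
    (hchar : ∀ k : ℕ, 1 ≤ k → k ≤ f.totalDegree → (k : K) ≠ 0) (T : Finset (NullLine K))
    (hT : ∀ l ∈ T, l.res f = 0 ∧ Singular f l) :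
    T.card ≤ f.totalDegree * (f.totalDegree - 1) := by
  have hpos := totalDegree_pos_of_not_isUnit hf.ne_zero hf.not_isUnit
  obtain ⟨i, hi⟩ := MvPolynomial.exists_pderiv_ne_zero hchar hpos
  have hle := totalDegree_pderiv_le i f
  have hdvd : ¬ f ∣ pderiv i f := fun h => by
    have := MvPolynomial.totalDegree_le_of_dvd_of_isDomain h hi
    omega
  exact (card_le_of_isRelPrime hf.ne_zero hi (hf.isRelPrime_iff_not_dvd.mpr hdvd) T
    fun l hl => ⟨(hT l hl).1, (hT l hl).2 i⟩).trans (by gcongr)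

theorem TriangleFree.res_ne_zero_of_not_singular {S : Finset (NullLine K)} (hS : TriangleFree S)
    {f : MvPolynomial (Fin 3) K} (hf : 0 < f.totalDegree) {m : NullLine K} (hm : m ∈ S)
    (hdeg : 4 * f.totalDegree ≤ (nbrs S m).card) (hv : ∀ l ∈ S, l.res f = 0)
    (hsing : ¬ Singular f m) (g : MvPolynomial (Fin 3) K)
    (hg : g = pderiv 2 f ∨
      g = pderiv 1 f + MvPolynomial.C (2 * m.slope) * pderiv 2 f) : m.res g ≠ 0 := by
  intro h0
  refine hsing fun i => hS.res_eq_zero hm subset_rfl (fun n hn => ?_) (by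
    have := totalDegree_pderiv_le i f
    omega)
  rw [mem_nbrs] at hn
  obtain ⟨hnS, hadj⟩ := hn
  set P := m.point (meet m n) with hP
  have hgP : MvPolynomial.eval P g = 0 := eval_point_of_res_eq_zero h0 _
  have h1 : MvPolynomial.eval P (nullDeriv m.slope f) = 0 :=
    eval_point_of_res_eq_zero (res_nullDeriv_eq_zero (hv m hm)) _
  have h2 : MvPolynomial.eval P (nullDeriv n.slope f) = 0 :=
    hadj.eval_point_meet (res_nullDeriv_eq_zero (hv n hnS))
  rw [eval_nullDeriv] at h1 h2
  set A := MvPolynomial.eval P (pderiv 2 f) with hA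
  set B := MvPolynomial.eval P (pderiv 1 f) with hB
  set C := MvPolynomial.eval P (pderiv 0 f) with hC
  have hne : m.slope - n.slope ≠ 0 := sub_ne_zero.mpr hadj.1
  have h3 : B + A * (m.slope + n.slope) = 0 :=
    (mul_eq_zero.mp (by linear_combination h1 - h2 :
      (m.slope - n.slope) * (B + A * (m.slope + n.slope)) = 0)).resolve_left hne
  have hA0 : A = 0 := by
    rcases hg with rfl | rfl
    · exact hgP
    · simp only [map_add, map_mul, MvPolynomial.eval_C, ← hA, ← hB] at hgP
      exact (mul_eq_zero.mp (by linear_combination hgP - h3 :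
        (m.slope - n.slope) * A = 0)).resolve_left hne
  have hB0 : B = 0 := by rw [hA0, zero_mul, add_zero] at h3; exact h3
  have hC0 : C = 0 := by rw [hA0, hB0] at h1; linear_combination h1
  fin_cases i
  · exact hC0
  · exact hB0
  · exact hA0

/-- An irreducible surface with a rich, triangle-free configuration of null lines is a plane or a
quadric. -/
theorem TriangleFree.totalDegree_le_two [Infinite K] {S : Finset (NullLine K)}
    (hS : TriangleFree S) {f : MvPolynomial (Fin 3) K} (hf : Irreducible f)
    (hchar : ∀ k : ℕ, 1 ≤ k → k ≤ f.totalDegree → (k : K) ≠ 0)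
    (hcard : 4 * f.totalDegree ^ 2 ≤ S.card)
    (hdeg : ∀ l ∈ S, 4 * f.totalDegree ≤ (nbrs S l).card) (hv : ∀ l ∈ S, l.res f = 0) :
    f.totalDegree ≤ 2 := by
  have hpos := totalDegree_pos_of_not_isUnit hf.ne_zero hf.not_isUnit
  obtain ⟨h1, h0⟩ := hS.dvd_flec hf hcard hdeg hv
  have hsing := card_singular_le hf hchar (S.filter (Singular f)) fun l hl =>
    ⟨hv l (Finset.mem_filter.mp hl).1, (Finset.mem_filter.mp hl).2⟩
  have hsum := Finset.card_filter_add_card_filter_not (s := S) (Singular f)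
  have hthree : 2 < (S.filter fun m => ¬ Singular f m).card := by
    obtain ⟨k, hk⟩ : ∃ k, f.totalDegree = k + 1 := ⟨f.totalDegree - 1, by omega⟩
    rw [hk] at hcard hsing
    rw [Nat.add_sub_cancel] at hsing
    nlinarith
  obtain ⟨m₁, m₂, m₃, hm₁, hm₂, hm₃, h12, h13, h23⟩ := Finset.two_lt_card_iff.mp hthree
  have hz : ∀ m ∈ S.filter fun m => ¬ Singular f m, m.res (pderiv 2 f) ≠ 0 := fun m hm => by
    rw [Finset.mem_filter] at hm
    exact hS.res_ne_zero_of_not_singular hpos hm.1 (hdeg m hm.1) hv hm.2 _ (Or.inl rfl)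
  have hdvd : ∀ m ∈ S.filter fun m => ¬ Singular f m, f ∣ incForm f m := fun m hm => by
    have hm' := Finset.mem_filter.mp hm
    refine dvd_of_infinite_res_eq_zero hf ((infinite_adj hchar h1 h0 (hv m hm'.1) (hz m hm)
      (hS.res_ne_zero_of_not_singular hpos hm'.1 (hdeg m hm'.1) hv hm'.2 _ (Or.inr rfl))).mono ?_)
    exact fun n hn => ⟨hn.1, hn.2.res_incForm hn.1⟩
  have hprod := incForm_identity f m₁ m₂ m₃
  have hdvd' : f ∣ pderiv 2 f * ((incB m₁ * incA m₂ - incA m₁ * incB m₂) *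
      (incB m₁ * incA m₃ - incA m₁ * incB m₃) *
      (incB m₂ * incA m₃ - incA m₂ * incB m₃)) := by
    rw [hprod]
    exact dvd_add (dvd_sub ((hdvd _ hm₁).mul_right _) ((hdvd _ hm₂).mul_right _))
      ((hdvd _ hm₃).mul_right _)
  have hfin : ∀ m m' : NullLine K, m ≠ m' → f ∣ incB m * incA m' - incA m * incB m' →
      f.totalDegree ≤ 2 := fun m m' hmm h =>
    (MvPolynomial.totalDegree_le_of_dvd_of_isDomain h (incB_mul_incA_sub_ne_zero hmm)).trans
      (totalDegree_incB_mul_incA_sub_le m m')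
  rcases hf.prime.dvd_or_dvd hdvd' with h | h
  · refine absurd ?_ (hz m₁ hm₁)
    obtain ⟨k, hk⟩ := h
    rw [hk, map_mul, hv m₁ (Finset.mem_filter.mp hm₁).1, zero_mul]
  · rcases hf.prime.dvd_or_dvd h with h | h
    · rcases hf.prime.dvd_or_dvd h with h | h
      · exact hfin _ _ h12 h
      · exact hfin _ _ h13 h
    · exact hfin _ _ h23 h

/-- The plane containing null lines of slopes `s` and `σ`. -/
noncomputable def planeForm (s σ κ : K) : MvPolynomial (Fin 3) K :=
  MvPolynomial.X 2 - MvPolynomial.C (s + σ) * MvPolynomial.X 1 +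
    MvPolynomial.C (s * σ) * MvPolynomial.X 0 - MvPolynomial.C κ

theorem res_planeForm (l : NullLine K) (s σ κ : K) : l.res (planeForm s σ κ) =
    Polynomial.C (l.z₀ - (s + σ) * l.y₀ - κ) +
      Polynomial.C ((l.slope - s) * (l.slope - σ)) * Polynomial.X := by
  simp only [planeForm, map_add, map_sub, map_mul, map_pow, res_C, res_X_zero, res_X_one,
    res_X_two]
  ring

theorem res_planeForm_eq_zero_iff {l : NullLine K} {s σ κ : K} : l.res (planeForm s σ κ) = 0 ↔
    (l.slope = s ∨ l.slope = σ) ∧ l.z₀ - (s + σ) * l.y₀ = κ := by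
  rw [res_planeForm]
  constructor
  · intro h
    have h0 := congrArg (fun q => Polynomial.coeff q 0) h
    have h1 := congrArg (fun q => Polynomial.coeff q 1) h
    simp only [Polynomial.coeff_add, Polynomial.coeff_C_mul, Polynomial.coeff_X_zero,
      Polynomial.coeff_X_one, Polynomial.coeff_C_zero, Polynomial.coeff_C_succ,
      Polynomial.coeff_zero, mul_zero, mul_one, add_zero, zero_add] at h0 h1
    exact ⟨(mul_eq_zero.mp h1).imp sub_eq_zero.mp sub_eq_zero.mp, sub_eq_zero.mp h0⟩
  · rintro ⟨h | h, hκ⟩ <;> simp [h, hκ]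

/-- An irreducible surface of degree at most two which contains three parallel null lines in a
plane is that plane. -/
theorem dvd_planeForm [Infinite K] {f : MvPolynomial (Fin 3) K} (hf : Irreducible f)
    (hdeg : f.totalDegree ≤ 2) {s σ κ : K} (hs : s ≠ σ) (T : Finset (NullLine K))
    (hT : 2 < T.card) (hσ : ∀ m ∈ T, m.slope = σ) (hκ : ∀ m ∈ T, m.z₀ - (s + σ) * m.y₀ = κ)
    (hv : ∀ m ∈ T, m.res f = 0) : f ∣ planeForm s σ κ := by
  obtain ⟨m₁, hm₁⟩ : T.Nonempty := Finset.card_pos.mp (by omega)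
  have hs' : s - σ ≠ 0 := sub_ne_zero.mpr hs
  refine dvd_of_infinite_res_eq_zero hf
    ((Set.infinite_range_of_injective (f := fun u => through (m₁.point u) s) ?_).mono ?_)
  · intro u v huv
    have h : m₁.y₀ + m₁.slope * u - s * u = m₁.y₀ + m₁.slope * v - s * v := congrArg y₀ huv
    rw [hσ m₁ hm₁] at h
    exact sub_eq_zero.mp ((mul_eq_zero.mp (by linear_combination -h :
      (s - σ) * (u - v) = 0)).resolve_left hs')
  · rintro _ ⟨u, rfl⟩
    refine ⟨?_, res_planeForm_eq_zero_iff.mpr ⟨Or.inl rfl, ?_⟩⟩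
    · refine res_eq_zero_of_eval_eq_zero _ (T.image fun m => u + (m.y₀ - m₁.y₀) / (s - σ)) ?_ ?_
      · intro t ht
        obtain ⟨m, hm, rfl⟩ := Finset.mem_image.mp ht
        suffices h : (through (m₁.point u) s).point (u + (m.y₀ - m₁.y₀) / (s - σ)) =
            m.point (u + (m.y₀ - m₁.y₀) / (s - σ)) by
          rw [h]
          exact eval_point_of_res_eq_zero (hv m hm) _
        have hz : m.z₀ = m₁.z₀ + (s + σ) * (m.y₀ - m₁.y₀) := by
          linear_combination hκ m hm - hκ m₁ hm₁
        have hq : (m.y₀ - m₁.y₀) / (s - σ) * (s - σ) = m.y₀ - m₁.y₀ := div_mul_cancel₀ _ hs'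
        simp only [point, through, Matrix.cons_val_zero, Matrix.cons_val_one, Matrix.cons_val,
          hσ m hm, hσ m₁ hm₁, hz]
        refine congrArg₂ (fun a b => ![u + (m.y₀ - m₁.y₀) / (s - σ), a, b]) ?_ ?_
        · linear_combination hq
        · linear_combination (s + σ) * hq
      · rw [Finset.card_image_of_injOn]
        · omega
        · intro m hm n hn hmn
          have hy : m.y₀ = n.y₀ :=
            sub_left_injective ((div_left_inj' hs').mp (add_left_cancel hmn))
          refine NullLine.ext ((hσ m hm).trans (hσ n hn).symm) hy ?_
          have := (hκ m hm).trans (hκ n hn).symm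
          rw [hy] at this
          exact sub_left_injective this
    · simp only [through, point, Matrix.cons_val_zero, Matrix.cons_val_one, Matrix.cons_val,
        hσ m₁ hm₁]
      linear_combination hκ m₁ hm₁

theorem Adj.plane_eq {l m : NullLine K} (h : Adj l m) :
    m.z₀ - (l.slope + m.slope) * m.y₀ = l.z₀ - (l.slope + m.slope) * l.y₀ := by
  obtain ⟨-, t, ht⟩ := h
  have h1 : l.y₀ + l.slope * t = m.y₀ + m.slope * t := by simpa [point] using congrFun ht 1
  have h2 : l.z₀ + l.slope ^ 2 * t = m.z₀ + m.slope ^ 2 * t := by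
    simpa [point] using congrFun ht 2
  linear_combination (l.slope + m.slope) * h1 - h2

/-- A set of null lines with at most `k` different slopes such that no plane contains more than
`k` parallel lines of the set. -/
def Spread (k : ℕ) (S : Finset (NullLine K)) : Prop :=
  (S.image slope).card ≤ k ∧
    ∀ σ a κ : K, (S.filter fun m => m.slope = σ ∧ m.z₀ - a * m.y₀ = κ).card ≤ k

theorem Spread.mono {k : ℕ} {S T : Finset (NullLine K)} (hS : Spread k S) (h : T ⊆ S) :
    Spread k T :=
  ⟨(Finset.card_le_card (Finset.image_subset_image h)).trans hS.1,
    fun σ a κ => (Finset.card_le_card (Finset.filter_subset_filter _ h)).trans (hS.2 σ a κ)⟩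

/-- On a plane or a quadric, a spread set of null lines has few incidences on each line. -/
theorem Spread.card_nbrs_le [Infinite K] {k : ℕ} {S : Finset (NullLine K)} (hS : Spread k S)
    {f : MvPolynomial (Fin 3) K} (hf : Irreducible f) (hdeg : f.totalDegree ≤ 2)
    (hv : ∀ l ∈ S, l.res f = 0) (l : NullLine K) : (nbrs S l).card ≤ 2 * k := by
  by_contra! hlt
  obtain ⟨σ, -, hσ⟩ := Finset.exists_lt_card_fiber_of_mul_lt_card_of_maps_to (s := nbrs S l)
    (t := S.image slope) (f := slope) (n := 2)
    (fun m hm => Finset.mem_image_of_mem _ (mem_nbrs.mp hm).1)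
    (lt_of_le_of_lt (by linarith [hS.1]) hlt)
  have hT : ∀ m ∈ (nbrs S l).filter (fun m => m.slope = σ), m ∈ S ∧ Adj l m ∧ m.slope = σ :=
    fun m hm => by
      rw [Finset.mem_filter, mem_nbrs] at hm
      exact ⟨hm.1.1, hm.1.2, hm.2⟩
  obtain ⟨m₀, hm₀⟩ := Finset.card_pos.mp (zero_lt_two.trans hσ)
  have hne : l.slope ≠ σ := by
    obtain ⟨-, h, hs⟩ := hT m₀ hm₀
    exact hs ▸ h.1
  have hdvd : f ∣ planeForm l.slope σ (l.z₀ - (l.slope + σ) * l.y₀) :=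
    dvd_planeForm hf hdeg hne _ hσ (fun m hm => (hT m hm).2.2)
      (fun m hm => by
        obtain ⟨-, h, hs⟩ := hT m hm
        rw [← hs]
        exact h.plane_eq)
      (fun m hm => hv m (hT m hm).1)
  have hsub : nbrs S l ⊆ S.filter fun m => m.slope = σ ∧
      m.z₀ - (l.slope + σ) * m.y₀ = l.z₀ - (l.slope + σ) * l.y₀ := by
    intro m hm
    rw [mem_nbrs] at hm
    obtain ⟨q, hq⟩ := hdvd
    have h0 : m.res (planeForm l.slope σ (l.z₀ - (l.slope + σ) * l.y₀)) = 0 := by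
      rw [hq, map_mul, hv m hm.1, zero_mul]
    obtain ⟨h1, h2⟩ := res_planeForm_eq_zero_iff.mp h0
    exact Finset.mem_filter.mpr ⟨hm.1, h1.resolve_left hm.2.1.symm, h2⟩
  have := (Finset.card_le_card hsub).trans (hS.2 _ _ _)
  omega

/-- A spread, triangle-free set of null lines contains a line with few incidences. -/
theorem TriangleFree.exists_card_nbrs_le [Infinite K] {S : Finset (NullLine K)}
    (hS : TriangleFree S) {k Y : ℕ} (hk : Spread k S) (hne : S.Nonempty)
    (hY : 36 * S.card ≤ Y ^ 2) (hkY : 3 * (2 * k + 1) ≤ 2 * Y)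
    (hchar : ∀ j : ℕ, 1 ≤ j → 12 * j ≤ Y → (j : K) ≠ 0) : ∃ l ∈ S, (nbrs S l).card ≤ Y := by
  by_contra! hlt
  set d := 3 * S.card / (Y + 1) with hd
  have hd1 : d * (Y + 1) ≤ 3 * S.card := Nat.div_mul_le_self _ _
  have hd2 : 3 * S.card < (d + 1) * (Y + 1) := by
    rw [mul_comm (d + 1)]
    exact Nat.lt_mul_div_succ _ Y.succ_pos
  have hd3 : 12 * d ≤ Y := by nlinarith
  have hd4 : 4 * d ^ 2 ≤ S.card := by nlinarith
  obtain ⟨f, hf, hfd, hv⟩ := exists_ne_zero_vanishing hS Y d (fun l hl => (hlt l hl).le)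
    (hd2.trans_le (by gcongr; omega))
  obtain ⟨g, S', hsub, hg, hgf, hne', hcard, hdeg, hgv⟩ :=
    exists_irreducible_vanishing (2 * k + 1) f S hf hS hne
      (le_trans (by gcongr) hd4) (fun l hl => by have := hlt l hl; omega) hv
  have hg2 := (hS.mono hsub).totalDegree_le_two hg (fun j hj hj' => hchar j hj (by omega)) hcard
    (fun l hl => le_of_add_le_right (hdeg l hl)) hgv
  obtain ⟨l, hl⟩ := hne'
  have h1 := hdeg l hl
  have h2 := (hk.mono hsub).card_nbrs_le hg hg2 hgv l
  omega

theorem sum_card_nbrs_erase {S : Finset (NullLine K)} {l : NullLine K} (hl : l ∈ S) :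
    ∑ m ∈ S, (nbrs S m).card =
      ∑ m ∈ S.erase l, (nbrs (S.erase l) m).card + 2 * (nbrs S l).card := by
  have h1 : ∀ m ∈ S.erase l, (nbrs S m).card =
      (nbrs (S.erase l) m).card + if Adj l m then 1 else 0 := by
    intro m hm
    conv_lhs => rw [← Finset.insert_erase hl]
    rw [nbrs, nbrs, Finset.filter_insert]
    by_cases h : Adj l m
    · rw [if_pos h, if_pos h.symm, Finset.card_insert_of_notMem (by simp)]
    · rw [if_neg h, if_neg fun h' => h h'.symm, add_zero]
  have h2 : ∑ m ∈ S.erase l, (if Adj l m then 1 else 0) = (nbrs S l).card := by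
    rw [← Finset.card_filter, nbrs]
    congr 1
    ext m
    simp only [Finset.mem_filter, Finset.mem_erase]
    exact ⟨fun h => ⟨h.1.2, h.2⟩, fun h => ⟨⟨fun hm => not_adj_self l (hm ▸ h.2), h.1⟩, h.2⟩⟩
  rw [← Finset.sum_erase_add _ _ hl, Finset.sum_congr rfl h1, Finset.sum_add_distrib, h2]
  ring

/-- An incidence bound for spread, triangle-free sets of null lines. -/
theorem TriangleFree.sum_card_nbrs_le [Infinite K] {S : Finset (NullLine K)}
    (hS : TriangleFree S) {k Y : ℕ} (hk : Spread k S)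
    (hY : 36 * S.card ≤ Y ^ 2) (hkY : 3 * (2 * k + 1) ≤ 2 * Y)
    (hchar : ∀ j : ℕ, 1 ≤ j → 12 * j ≤ Y → (j : K) ≠ 0) :
    ∑ l ∈ S, (nbrs S l).card ≤ 2 * Y * S.card := by
  induction hn : S.card generalizing S with
  | zero => rw [Finset.card_eq_zero.mp hn]; simp
  | succ n ih =>
    obtain ⟨l, hl, hlY⟩ :=
      hS.exists_card_nbrs_le hk (Finset.card_pos.mp (by omega)) hY hkY hchar
    have hc : (S.erase l).card = n := by rw [Finset.card_erase_of_mem hl, hn, Nat.add_sub_cancel]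
    have hsub := Finset.erase_subset l S
    have := ih (hS.mono hsub) (hk.mono hsub) (by omega) hc
    rw [sum_card_nbrs_erase hl]
    linarith

end NullLine

theorem Finset.card_le_two_of_quadratic {ι K : Type*} [Field K] (T : Finset ι) (g : ι → K)
    (hg : Set.InjOn g T) (p q : K) (h : ∀ i ∈ T, g i ^ 2 + p * g i = q) : T.card ≤ 2 := by
  by_contra! hlt
  obtain ⟨i, j, k, hi, hj, hk, hij, hik, hjk⟩ := Finset.two_lt_card_iff.mp hlt
  have h1 : (g i - g j) * (g i + g j + p) = 0 := by linear_combination h i hi - h j hj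
  have h2 : (g i - g k) * (g i + g k + p) = 0 := by linear_combination h i hi - h k hk
  have h3 := (mul_eq_zero.mp h1).resolve_left (sub_ne_zero.mpr fun e => hij (hg hi hj e))
  have h4 := (mul_eq_zero.mp h2).resolve_left (sub_ne_zero.mpr fun e => hik (hg hi hk e))
  exact hjk (hg hj hk (by linear_combination h3 - h4))

theorem exists_forall_quadratic_ne_zero {K : Type*} [Field K] [Infinite K]
    (Q : Finset (K × K × K)) :
    ∃ t : K, ∀ q ∈ Q, (q.1 ≠ 0 ∨ q.2.1 ≠ 0) → q.1 * t ^ 2 + q.2.1 * t + q.2.2 ≠ 0 := by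
  set P : K × K × K → Polynomial K := fun q =>
    Polynomial.C q.1 * Polynomial.X ^ 2 + Polynomial.C q.2.1 * Polynomial.X +
      Polynomial.C q.2.2 with hP
  have hne : ∏ q ∈ Q.filter (fun q => q.1 ≠ 0 ∨ q.2.1 ≠ 0), P q ≠ 0 := by
    refine Finset.prod_ne_zero_iff.mpr fun q hq h0 => ?_
    have h2 := congrArg (fun r => Polynomial.coeff r 2) h0
    have h1 := congrArg (fun r => Polynomial.coeff r 1) h0
    simp [hP, Polynomial.coeff_C] at h1 h2
    exact (Finset.mem_filter.mp hq).2.elim (fun h => h h2) (fun h => h h1)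
  obtain ⟨t, ht⟩ := Polynomial.exists_eval_ne_zero_of_natDegree_lt_card _ hne
    (Cardinal.natCast_lt_aleph0.trans_le (Cardinal.aleph0_le_mk K))
  refine ⟨t, fun q hq hq0 h => ht ?_⟩
  rw [Polynomial.eval_prod]
  refine Finset.prod_eq_zero (Finset.mem_filter.mpr ⟨hq, hq0⟩) ?_
  simpa [hP] using h

namespace NullLine

variable {K : Type*} [Field K]

theorem adj_iff {l m : NullLine K} : Adj l m ↔ l.slope ≠ m.slope ∧
    m.z₀ - (l.slope + m.slope) * m.y₀ = l.z₀ - (l.slope + m.slope) * l.y₀ := by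
  refine ⟨fun h => ⟨h.1, h.plane_eq⟩, fun ⟨hs, h⟩ => ⟨hs, (m.y₀ - l.y₀) / (l.slope - m.slope), ?_⟩⟩
  have hq := div_mul_cancel₀ (m.y₀ - l.y₀) (sub_ne_zero.mpr hs)
  refine congrArg₂ (fun a b => ![(m.y₀ - l.y₀) / (l.slope - m.slope), a, b]) ?_ ?_
  · linear_combination hq
  · linear_combination (l.slope + m.slope) * hq - h

/-- The null line encoding the ordinate `r.1` of a pin and the abscissae `r.2` of two points. -/
def redLine (τ : K) (r : K × K × K) : NullLine K :=
  ⟨r.1, -2 * (r.2.1 - r.2.2),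
    r.2.1 ^ 2 - r.2.2 ^ 2 + τ ^ 2 * r.1 + τ * (r.2.1 - r.2.2) - 2 * r.1 * (r.2.1 - r.2.2)⟩

/-- The null line encoding the abscissa `r.1` of a pin and the ordinates `r.2` of two points. -/
def blueLine (τ : K) (r : K × K × K) : NullLine K :=
  ⟨-r.1 - τ / 2, 2 * (r.2.1 - r.2.2) - τ ^ 2,
    r.2.1 ^ 2 - r.2.2 ^ 2 - (r.1 + τ / 2) * (2 * (r.2.1 - r.2.2) - τ ^ 2)⟩

/-- The coefficients of the quadratic polynomial in `τ` whose nonvanishing guarantees that lines of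
the same colour do not meet. -/
def sameColour (r r' : K × K × K) : K × K × K :=
  (r.1 - r'.1, (r.2.1 - r.2.2) - (r'.2.1 - r'.2.2),
    r.2.1 ^ 2 - r.2.2 ^ 2 - (r'.2.1 ^ 2 - r'.2.2 ^ 2) +
      2 * (r'.1 * (r.2.1 - r.2.2) - r.1 * (r'.2.1 - r'.2.2)))

/-- The parameter `τ` makes lines of the same colour disjoint, and makes slopes of lines of
different colours different. -/
def Generic (A : Finset K) (τ : K) : Prop :=
  (∀ r ∈ A ×ˢ A ×ˢ A, ∀ r' ∈ A ×ˢ A ×ˢ A, r.1 ≠ r'.1 →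
    (sameColour r r').1 * τ ^ 2 + (sameColour r r').2.1 * τ + (sameColour r r').2.2 ≠ 0) ∧
  ∀ a ∈ A, ∀ b ∈ A, 2 * (a + b) + τ ≠ 0

theorem exists_generic [Infinite K] (A : Finset K) : ∃ τ, Generic A τ := by
  obtain ⟨τ, hτ⟩ := exists_forall_quadratic_ne_zero
    (((A ×ˢ A ×ˢ A) ×ˢ A ×ˢ A ×ˢ A).image (fun x => sameColour x.1 x.2) ∪
      (A ×ˢ A).image fun x => (0, 1, 2 * (x.1 + x.2)))
  refine ⟨τ, fun r hr r' hr' hne => hτ _ (Finset.mem_union_left _ ?_)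
    (Or.inl (sub_ne_zero.mpr hne)), fun a ha b hb => ?_⟩
  · exact Finset.mem_image.mpr ⟨(r, r'), Finset.mem_product.mpr ⟨hr, hr'⟩, rfl⟩
  · have := hτ (0, 1, 2 * (a + b)) (Finset.mem_union_right _
      (Finset.mem_image.mpr ⟨(a, b), Finset.mem_product.mpr ⟨ha, hb⟩, rfl⟩)) (Or.inr one_ne_zero)
    rwa [zero_mul, zero_add, one_mul, add_comm] at this

theorem redLine_not_adj {A : Finset K} {τ : K} (hτ : Generic A τ) {r r' : K × K × K}
    (hr : r ∈ A ×ˢ A ×ˢ A) (hr' : r' ∈ A ×ˢ A ×ˢ A) : ¬ Adj (redLine τ r) (redLine τ r') := by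
  rw [adj_iff]
  rintro ⟨hs, h⟩
  refine hτ.1 r hr r' hr' hs ?_
  simp only [redLine, sameColour] at h ⊢
  linear_combination -h

theorem blueLine_not_adj {A : Finset K} {τ : K} (hτ : Generic A τ) (h2 : (2 : K) ≠ 0)
    {r r' : K × K × K} (hr : r ∈ A ×ˢ A ×ˢ A) (hr' : r' ∈ A ×ˢ A ×ˢ A) :
    ¬ Adj (blueLine τ r) (blueLine τ r') := by
  rw [adj_iff]
  rintro ⟨hs, h⟩
  refine hτ.1 r hr r' hr' (fun e => hs (by simp [blueLine, e])) ?_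
  simp only [blueLine, sameColour] at h ⊢
  field_simp at h
  refine mul_left_cancel₀ h2 ?_
  linear_combination -h

theorem redLine_adj_blueLine {A : Finset K} {τ : K} (hτ : Generic A τ) (h2 : (2 : K) ≠ 0)
    {r r' : K × K × K} (hr : r.1 ∈ A) (hr' : r'.1 ∈ A)
    (h : 2 * r.1 * (r'.2.1 - r'.2.2) - (r'.2.1 ^ 2 - r'.2.2 ^ 2) =
      2 * r'.1 * (r.2.1 - r.2.2) - (r.2.1 ^ 2 - r.2.2 ^ 2)) :
    Adj (redLine τ r) (blueLine τ r') := by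
  rw [adj_iff]
  constructor
  · intro hs
    simp only [redLine, blueLine] at hs
    refine hτ.2 _ hr _ hr' ?_
    field_simp at hs
    linear_combination hs
  · simp only [redLine, blueLine]
    field_simp
    linear_combination (-2) * h

theorem eq_of_sub_eq_of_sq_sub_eq (h2 : (2 : K) ≠ 0) {x y x' y' : K} (hne : x ≠ y)
    (h1 : x - y = x' - y') (hsq : x ^ 2 - y ^ 2 = x' ^ 2 - y' ^ 2) : x = x' ∧ y = y' := by
  have h3 : (x - y) * (2 * (x - x')) = 0 := by
    linear_combination hsq + (x - y - (x' + y')) * h1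
  have h4 : x = x' := sub_eq_zero.mp ((mul_eq_zero.mp
    ((mul_eq_zero.mp h3).resolve_left (sub_ne_zero.mpr hne))).resolve_left h2)
  exact ⟨h4, by linear_combination h4 - h1⟩

theorem redLine_injOn (τ : K) (h2 : (2 : K) ≠ 0) :
    Set.InjOn (redLine τ) {r | r.2.1 ≠ r.2.2} := by
  rintro ⟨a, x, y⟩ hr ⟨a', x', y'⟩ - h
  have ha : a = a' := congrArg slope h
  have hy : -2 * (x - y) = -2 * (x' - y') := congrArg y₀ h
  have hz : x ^ 2 - y ^ 2 + τ ^ 2 * a + τ * (x - y) - 2 * a * (x - y) =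
    x' ^ 2 - y' ^ 2 + τ ^ 2 * a' + τ * (x' - y') - 2 * a' * (x' - y') := congrArg z₀ h
  have hu := mul_left_cancel₀ (neg_ne_zero.mpr h2) hy
  rw [ha, hu] at hz
  obtain ⟨rfl, rfl⟩ := eq_of_sub_eq_of_sq_sub_eq h2 hr hu (by linear_combination hz)
  rw [ha]

theorem blueLine_injOn (τ : K) (h2 : (2 : K) ≠ 0) :
    Set.InjOn (blueLine τ) {r | r.2.1 ≠ r.2.2} := by
  rintro ⟨a, x, y⟩ hr ⟨a', x', y'⟩ - h
  have ha : -a - τ / 2 = -a' - τ / 2 := congrArg slope h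
  have ha : a = a' := by linear_combination -ha
  have hy : 2 * (x - y) - τ ^ 2 = 2 * (x' - y') - τ ^ 2 := congrArg y₀ h
  have hz : x ^ 2 - y ^ 2 - (a + τ / 2) * (2 * (x - y) - τ ^ 2) =
    x' ^ 2 - y' ^ 2 - (a' + τ / 2) * (2 * (x' - y') - τ ^ 2) := congrArg z₀ h
  have hu := mul_left_cancel₀ h2 (sub_left_injective hy)
  rw [ha, hu] at hz
  obtain ⟨rfl, rfl⟩ := eq_of_sub_eq_of_sq_sub_eq h2 hr hu (by linear_combination hz)
  rw [ha]

/-- The coloured null lines attached to a set of coordinates. -/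
noncomputable def lines (τ : K) (A : Finset K) : Finset (NullLine K) :=
  (A ×ˢ A ×ˢ A).image (redLine τ) ∪ (A ×ˢ A ×ˢ A).image (blueLine τ)

theorem card_lines_le (τ : K) (A : Finset K) : (lines τ A).card ≤ 2 * A.card ^ 3 := by
  refine (Finset.card_union_le _ _).trans
    ((add_le_add Finset.card_image_le Finset.card_image_le).trans (le_of_eq ?_))
  simp only [Finset.card_product]
  ring

theorem triangleFree_lines {A : Finset K} {τ : K} (hτ : Generic A τ) (h2 : (2 : K) ≠ 0) :
    TriangleFree (lines τ A) := by
  have hR : ∀ l ∈ (A ×ˢ A ×ˢ A).image (redLine τ), ∀ m ∈ (A ×ˢ A ×ˢ A).image (redLine τ),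
      ¬ Adj l m := by
    intro l hl m hm
    obtain ⟨r, hr, rfl⟩ := Finset.mem_image.mp hl
    obtain ⟨r', hr', rfl⟩ := Finset.mem_image.mp hm
    exact redLine_not_adj hτ hr hr'
  have hB : ∀ l ∈ (A ×ˢ A ×ˢ A).image (blueLine τ), ∀ m ∈ (A ×ˢ A ×ˢ A).image (blueLine τ),
      ¬ Adj l m := by
    intro l hl m hm
    obtain ⟨r, hr, rfl⟩ := Finset.mem_image.mp hl
    obtain ⟨r', hr', rfl⟩ := Finset.mem_image.mp hm
    exact blueLine_not_adj hτ h2 hr hr'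
  intro l hl m hm k hk hlm hlk hmk
  rcases Finset.mem_union.mp hl with hl | hl <;> rcases Finset.mem_union.mp hm with hm | hm <;>
    rcases Finset.mem_union.mp hk with hk | hk <;>
    first
    | exact hR _ hl _ hm hlm
    | exact hR _ hl _ hk hlk
    | exact hR _ hm _ hk hmk
    | exact hB _ hl _ hm hlm
    | exact hB _ hl _ hk hlk
    | exact hB _ hm _ hk hmk

theorem card_filter_quadratic_le (A : Finset K) (σ p q : K) :
    ((A ×ˢ A ×ˢ A).filter fun r => r.1 = σ ∧
      r.2.1 ^ 2 - r.2.2 ^ 2 + p * (r.2.1 - r.2.2) = q).card ≤ 2 * A.card := by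
  refine Finset.card_le_mul_card_image_of_maps_to (f := fun r => r.2.2) (fun r hr => ?_) 2
    fun y _ => ?_
  · simp only [Finset.mem_filter, Finset.mem_product] at hr
    exact hr.1.2.2
  · refine Finset.card_le_two_of_quadratic _ (fun r => r.2.1) ?_ p (q + y ^ 2 + p * y) ?_
    · intro r hr r' hr' h
      simp only [Finset.coe_filter, Finset.mem_filter, Set.mem_ofPred_eq] at hr hr'
      exact Prod.ext (hr.1.2.1.trans hr'.1.2.1.symm) (Prod.ext h (hr.2.trans hr'.2.symm))
    · intro r hr
      simp only [Finset.mem_filter] at hr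
      obtain ⟨⟨-, -, h⟩, rfl⟩ := hr
      linear_combination h

theorem spread_lines (τ : K) (A : Finset K) : Spread (4 * A.card) (lines τ A) := by
  constructor
  · have hsub : (lines τ A).image slope ⊆ A ∪ A.image fun b => -b - τ / 2 := by
      intro s hs
      obtain ⟨l, hl, rfl⟩ := Finset.mem_image.mp hs
      rcases Finset.mem_union.mp hl with hl | hl <;>
        obtain ⟨r, hr, rfl⟩ := Finset.mem_image.mp hl <;>
        have hr := (Finset.mem_product.mp hr).1
      · exact Finset.mem_union_left _ hr
      · exact Finset.mem_union_right _ (Finset.mem_image_of_mem (fun b => -b - τ / 2) hr)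
    have h1 := (Finset.card_le_card hsub).trans (Finset.card_union_le _ _)
    have h2 : (A.image fun b => -b - τ / 2).card ≤ A.card := Finset.card_image_le
    omega
  · intro σ a κ
    have hsub : ((lines τ A).filter fun m => m.slope = σ ∧ m.z₀ - a * m.y₀ = κ) ⊆
        ((A ×ˢ A ×ˢ A).filter fun r => r.1 = σ ∧ r.2.1 ^ 2 - r.2.2 ^ 2 +
          (τ - 2 * σ + 2 * a) * (r.2.1 - r.2.2) = κ - τ ^ 2 * σ).image (redLine τ) ∪
        ((A ×ˢ A ×ˢ A).filter fun r => r.1 = -σ - τ / 2 ∧ r.2.1 ^ 2 - r.2.2 ^ 2 +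
          (2 * (σ - a)) * (r.2.1 - r.2.2) = κ + (σ - a) * τ ^ 2).image (blueLine τ) := by
      intro l hl
      obtain ⟨hl, hs, hκ⟩ := Finset.mem_filter.mp hl
      rcases Finset.mem_union.mp hl with hl | hl <;>
        obtain ⟨r, hr, rfl⟩ := Finset.mem_image.mp hl
      · refine Finset.mem_union_left _ (Finset.mem_image_of_mem _
          (Finset.mem_filter.mpr ⟨hr, hs, ?_⟩))
        simp only [redLine] at hs hκ
        rw [hs] at hκ
        linear_combination hκ
      · simp only [blueLine] at hs hκ
        have hs' : r.1 = -σ - τ / 2 := by linear_combination -hs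
        refine Finset.mem_union_right _ (Finset.mem_image_of_mem _
          (Finset.mem_filter.mpr ⟨hr, hs', ?_⟩))
        rw [hs'] at hκ
        linear_combination hκ
    refine (Finset.card_le_card hsub).trans ((Finset.card_union_le _ _).trans
      ((add_le_add (Finset.card_image_le.trans (card_filter_quadratic_le _ _ _ _))
        (Finset.card_image_le.trans (card_filter_quadratic_le _ _ _ _))).trans ?_))
    omega

end NullLine

theorem Finset.sq_card_le_card_image_mul {α β : Type*} (s : Finset α) (f : α → β) :
    s.card ^ 2 ≤ (s.image f).card * ((s ×ˢ s).filter fun x => f x.1 = f x.2).card := by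
  have h1 : ((s ×ˢ s).filter fun x => f x.1 = f x.2).card =
      ∑ b ∈ s.image f, (s.filter fun a => f a = b).card ^ 2 := by
    rw [Finset.card_eq_sum_card_fiberwise (f := fun x : α × α => f x.1) (t := s.image f)]
    · refine Finset.sum_congr rfl fun b _ => ?_
      rw [sq, ← Finset.card_product]
      congr 1
      ext x
      simp only [Finset.mem_filter, Finset.mem_product]
      constructor
      · rintro ⟨⟨⟨h1, h2⟩, h3⟩, h4⟩
        exact ⟨⟨h1, h4⟩, h2, h3 ▸ h4⟩
      · rintro ⟨⟨h1, h4⟩, h2, h5⟩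
        exact ⟨⟨⟨h1, h2⟩, h4.trans h5.symm⟩, h4⟩
    · intro x hx
      exact Finset.mem_image_of_mem f
        (Finset.mem_product.mp (Finset.mem_filter.mp hx).1).1
  rw [h1, Finset.card_eq_sum_card_image f s]
  exact sq_sum_le_card_mul_sum_sq

section energy

variable {K : Type*} [Field K]

/-- The isosceles triples with apex and base points in `A × A`. -/
noncomputable def isosceles (A : Finset K) : Finset ((K × K) × (K × K) × K × K) :=
  ((A ×ˢ A) ×ˢ (A ×ˢ A) ×ˢ A ×ˢ A).filter fun w => sqDist w.1 w.2.1 = sqDist w.1 w.2.2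

theorem mem_isosceles {A : Finset K} {w : (K × K) × (K × K) × K × K} : w ∈ isosceles A ↔
    ((w.1.1 ∈ A ∧ w.1.2 ∈ A) ∧ (w.2.1.1 ∈ A ∧ w.2.1.2 ∈ A) ∧ w.2.2.1 ∈ A ∧ w.2.2.2 ∈ A) ∧
      sqDist w.1 w.2.1 = sqDist w.1 w.2.2 := by
  simp only [isosceles, Finset.mem_filter, Finset.mem_product]

theorem card_isosceles_fst_eq_le (A : Finset K) :
    ((isosceles A).filter fun w => w.2.1.1 = w.2.2.1).card ≤ 2 * A.card ^ 4 := by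
  refine (Finset.card_le_mul_card_image_of_maps_to (f := fun w => (w.1, w.2.1))
    (t := (A ×ˢ A) ×ˢ A ×ˢ A) (fun w hw => ?_) 2 fun q _ => ?_).trans (le_of_eq ?_)
  · have := (mem_isosceles.mp (Finset.mem_filter.mp hw).1).1
    simp only [Finset.mem_product]
    exact ⟨this.1, this.2.1⟩
  · refine Finset.card_le_two_of_quadratic _ (fun w => w.2.2.2) ?_ (-2 * q.1.2)
      (q.2.2 ^ 2 - 2 * q.1.2 * q.2.2) ?_
    · rintro ⟨⟨a, b⟩, ⟨x, y⟩, x', y'⟩ h ⟨⟨c, d⟩, ⟨z, w⟩, z', w'⟩ h' hyw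
      simp only [Finset.coe_filter, Finset.mem_filter, Set.mem_ofPred_eq] at h h' hyw
      obtain ⟨⟨-, h⟩, rfl⟩ := h
      obtain ⟨⟨-, h'⟩, h''⟩ := h'
      grind
    · rintro ⟨⟨a, b⟩, ⟨x, y⟩, x', y'⟩ h
      simp only [Finset.mem_filter, mem_isosceles, sqDist] at h
      obtain ⟨⟨⟨-, h⟩, rfl⟩, rfl⟩ := h
      linear_combination -h
  · simp only [Finset.card_product]
    ring

theorem card_isosceles_snd_eq_le (A : Finset K) :
    ((isosceles A).filter fun w => w.2.1.2 = w.2.2.2).card ≤ 2 * A.card ^ 4 := by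
  refine le_trans ?_ (card_isosceles_fst_eq_le A)
  refine Finset.card_le_card_of_injOn (fun w => (w.1.swap, w.2.1.swap, w.2.2.swap)) ?_ ?_
  · intro w hw
    simp only [Finset.coe_filter, mem_isosceles, sqDist, Set.mem_ofPred_eq, Prod.fst_swap,
      Prod.snd_swap] at hw ⊢
    obtain ⟨⟨⟨h1, h2, h3⟩, h4⟩, h5⟩ := hw
    exact ⟨⟨⟨h1.symm, h2.symm, h3.symm⟩, by linear_combination h4⟩, h5⟩
  · intro w _ w' _ h
    simp only [Prod.mk.injEq, Prod.swap_inj] at h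
    exact Prod.ext h.1 (Prod.ext h.2.1 h.2.2)

open NullLine in
theorem card_isosceles_ne_le {A : Finset K} {τ : K} (hτ : Generic A τ) (h2 : (2 : K) ≠ 0) :
    ((isosceles A).filter fun w => w.2.1.1 ≠ w.2.2.1 ∧ w.2.1.2 ≠ w.2.2.2).card ≤
      ∑ l ∈ lines τ A, (nbrs (lines τ A) l).card := by
  rw [← Finset.card_sigma]
  refine Finset.card_le_card_of_injOn (fun w => ⟨redLine τ (w.1.1, w.2.2.2, w.2.1.2),
    blueLine τ (w.1.2, w.2.1.1, w.2.2.1)⟩) ?_ ?_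
  · rintro ⟨⟨a, b⟩, ⟨x, y⟩, x', y'⟩ h
    simp only [Finset.coe_filter, mem_isosceles, sqDist, Set.mem_ofPred_eq] at h
    obtain ⟨⟨⟨⟨ha, hb⟩, ⟨hx, hy⟩, hx', hy'⟩, h⟩, -⟩ := h
    refine Finset.mem_sigma.mpr ⟨Finset.mem_union_left _ (Finset.mem_image_of_mem _ ?_),
      mem_nbrs.mpr ⟨Finset.mem_union_right _ (Finset.mem_image_of_mem _ ?_),
        redLine_adj_blueLine hτ h2 ha hb ?_⟩⟩
    · exact Finset.mk_mem_product ha (Finset.mk_mem_product hy' hy)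
    · exact Finset.mk_mem_product hb (Finset.mk_mem_product hx hx')
    · linear_combination -h
  · rintro ⟨⟨a, b⟩, ⟨x, y⟩, x', y'⟩ h ⟨⟨c, d⟩, ⟨z, w⟩, z', w'⟩ h' he
    simp only [Finset.coe_filter, Set.mem_ofPred_eq] at h h'
    simp only [Sigma.mk.injEq, heq_eq_eq] at he
    have h3 := redLine_injOn τ h2 h.2.2.symm h'.2.2.symm he.1
    have h4 := blueLine_injOn τ h2 h.2.1 h'.2.1 he.2
    simp only [Prod.mk.injEq] at h3 h4 ⊢
    tauto

/-- There are few isosceles triples in a Cartesian product. -/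
theorem card_isosceles_le [Infinite K] (A : Finset K) {m : ℕ} (hm : A.card < m) (hm2 : 2 ≤ m)
    (hmA : A.card ^ 3 ≤ m ^ 2) (hchar : ∀ j : ℕ, 1 ≤ j → j ≤ m → (j : K) ≠ 0) :
    (isosceles A).card ≤ 52 * m * A.card ^ 3 := by
  have h2 : (2 : K) ≠ 0 := by exact_mod_cast hchar 2 one_le_two hm2
  obtain ⟨τ, hτ⟩ := NullLine.exists_generic A
  have hcard := NullLine.card_lines_le τ A
  have h3 := (NullLine.triangleFree_lines hτ h2).sum_card_nbrs_le (NullLine.spread_lines τ A)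
    (Y := 12 * m) (by linarith) (by omega) (fun j hj hj' => hchar j hj (by omega))
  have h4 := card_isosceles_ne_le hτ h2
  have h5 : isosceles A ⊆ ((isosceles A).filter fun w => w.2.1.1 = w.2.2.1) ∪
      ((isosceles A).filter fun w => w.2.1.2 = w.2.2.2) ∪
      (isosceles A).filter fun w => w.2.1.1 ≠ w.2.2.1 ∧ w.2.1.2 ≠ w.2.2.2 := by
    intro w hw
    simp only [Finset.mem_union, Finset.mem_filter]
    tauto
  have h6 := (Finset.card_le_card h5).trans ((Finset.card_union_le _ _).trans
    (Nat.add_le_add_right (Finset.card_union_le _ _) _))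
  have h7 := card_isosceles_fst_eq_le A
  have h8 := card_isosceles_snd_eq_le A
  have h9 : 2 * (12 * m) * (NullLine.lines τ A).card ≤ 2 * (12 * m) * (2 * A.card ^ 3) := by
    gcongr
  have h10 : A.card ^ 4 ≤ m * A.card ^ 3 := by
    rw [pow_succ']
    gcongr
  linarith

theorem exists_card_pinnedDists_ge {A : Finset K} (hA : A.Nonempty) :
    ∃ q ∈ A ×ˢ A, A.card ^ 6 ≤ (pinnedDists q (A ×ˢ A)).card * (isosceles A).card := by
  obtain ⟨q, hq, hmax⟩ := Finset.exists_max_image (A ×ˢ A)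
    (fun q => (pinnedDists q (A ×ˢ A)).card) (hA.product hA)
  refine ⟨q, hq, ?_⟩
  have h1 : (isosceles A).card = ∑ o ∈ A ×ˢ A,
      (((A ×ˢ A) ×ˢ A ×ˢ A).filter fun x => sqDist o x.1 = sqDist o x.2).card := by
    rw [isosceles, Finset.card_filter, Finset.sum_product]
    exact Finset.sum_congr rfl fun o _ => (Finset.card_filter _ _).symm
  have h2 : ∀ o ∈ A ×ˢ A, A.card ^ 4 ≤ (pinnedDists q (A ×ˢ A)).card *
      (((A ×ˢ A) ×ˢ A ×ˢ A).filter fun x => sqDist o x.1 = sqDist o x.2).card := by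
    intro o ho
    have h3 := Finset.sq_card_le_card_image_mul (A ×ˢ A) (sqDist o)
    rw [Finset.card_product] at h3
    calc A.card ^ 4 = (A.card * A.card) ^ 2 := by ring
      _ ≤ _ := h3
      _ ≤ _ := Nat.mul_le_mul_right _ (hmax o ho)
  rw [h1, Finset.mul_sum]
  refine le_trans (le_of_eq ?_) (Finset.card_nsmul_le_sum _ _ _ h2)
  rw [Finset.card_product, smul_eq_mul]
  ring

theorem card_isosceles_image {L : Type*} [Field L] (φ : K →+* L) (A : Finset K) :
    (isosceles A).card ≤ (isosceles (A.image φ)).card := by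
  have hφ : ∀ q r : K × K, sqDist (Prod.map φ φ q) (Prod.map φ φ r) = φ (sqDist q r) := by
    intro q r
    simp [sqDist]
  refine Finset.card_le_card_of_injOn
    (Prod.map (Prod.map φ φ) (Prod.map (Prod.map φ φ) (Prod.map φ φ))) ?_ ?_
  · intro w hw
    rw [Finset.mem_coe, mem_isosceles] at hw ⊢
    obtain ⟨⟨⟨h1, h2⟩, ⟨h3, h4⟩, h5, h6⟩, h⟩ := hw
    exact ⟨⟨⟨Finset.mem_image_of_mem φ h1, Finset.mem_image_of_mem φ h2⟩,
      ⟨Finset.mem_image_of_mem φ h3, Finset.mem_image_of_mem φ h4⟩,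
      Finset.mem_image_of_mem φ h5, Finset.mem_image_of_mem φ h6⟩,
      (hφ _ _).trans ((congrArg φ h).trans (hφ _ _).symm)⟩
  · have h := φ.injective.prodMap φ.injective
    exact (h.prodMap (h.prodMap h)).injOn

end energy

theorem stmt_16 :
    ∃ c C : ℝ, 0 < c ∧ 0 < C ∧
      ∀ (F : Type) [Field F] (A : Finset F), 2 ≤ A.card →
        (∀ p : ℕ, p.Prime → CharP F p → (A.card : ℝ) ≤ c * (p : ℝ) ^ ((2 : ℝ) / 3)) →
        ∃ q ∈ A ×ˢ A,
          C * (A.card : ℝ) ^ ((5 : ℝ) / 4) ≤ ((pinnedDists q (A ×ˢ A)).card : ℝ) := by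
  refine ⟨1 / 4, 1 / 104, by norm_num, by norm_num, fun F _ A hA hp => ?_⟩
  set n := A.card with hn
  set m := Nat.sqrt (n ^ 3) + 1 with hm
  have hm1 : n < m := by
    rw [hm, Nat.lt_succ_iff, Nat.le_sqrt']
    exact Nat.pow_le_pow_right (by omega) (by norm_num)
  have hm2 : n ^ 3 ≤ m ^ 2 := (Nat.lt_succ_sqrt' _).le
  have hm3 : (m - 1) ^ 2 ≤ n ^ 3 := by
    rw [hm, Nat.add_sub_cancel]
    exact Nat.sqrt_le' _
  have hchar : ∀ j : ℕ, 1 ≤ j → j ≤ m → (j : AlgebraicClosure F) ≠ 0 := by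
    intro j hj hjm h0
    have h0' : (j : F) = 0 := by
      apply (algebraMap F (AlgebraicClosure F)).injective
      rw [map_natCast, h0, map_zero]
    obtain ⟨p, hpF⟩ := CharP.exists F
    rw [CharP.cast_eq_zero_iff F p] at h0'
    have hple := Nat.le_of_dvd hj h0'
    have hp0 : p ≠ 0 := by
      rintro rfl
      exact absurd (Nat.eq_zero_of_zero_dvd h0') (by omega)
    have hpp : p.Prime := (CharP.char_is_prime_or_zero F p).resolve_right hp0
    have hb := hp p hpp hpF
    have hcube : (n : ℝ) ^ 3 ≤ (p : ℝ) ^ 2 / 64 := by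
      calc (n : ℝ) ^ 3 ≤ (1 / 4 * (p : ℝ) ^ ((2 : ℝ) / 3)) ^ 3 := by gcongr
        _ = (p : ℝ) ^ 2 / 64 := by
          rw [mul_pow, ← Real.rpow_natCast ((p : ℝ) ^ ((2 : ℝ) / 3)) 3,
            ← Real.rpow_mul (Nat.cast_nonneg p)]
          norm_num
          ring
    have hcube' : 64 * n ^ 3 ≤ p ^ 2 := by
      have : (64 : ℝ) * (n : ℝ) ^ 3 ≤ (p : ℝ) ^ 2 := by linarith
      exact_mod_cast this
    have hk : 8 * (m - 1) ≤ p := by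
      refine (Nat.pow_le_pow_iff_left two_ne_zero).mp ?_
      nlinarith
    omega
  obtain ⟨q, hq, hcard⟩ := exists_card_pinnedDists_ge (A := A) (Finset.card_pos.mp (by omega))
  refine ⟨q, hq, ?_⟩
  have himg : (A.image (algebraMap F (AlgebraicClosure F))).card = n :=
    Finset.card_image_of_injective _ (algebraMap F (AlgebraicClosure F)).injective
  have hE := (card_isosceles_image (algebraMap F (AlgebraicClosure F)) A).trans
    (card_isosceles_le (m := m) _ (by omega) (by omega) (by rwa [himg]) hchar)
  rw [himg] at hE
  set D := (pinnedDists q (A ×ˢ A)).card with hD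
  have hn3 : 0 < n ^ 3 := by positivity
  have h1 : n ^ 3 ≤ 52 * m * D := by
    refine Nat.le_of_mul_le_mul_right ?_ hn3
    calc n ^ 3 * n ^ 3 = n ^ 6 := by ring
      _ ≤ D * (52 * m * n ^ 3) := hcard.trans (Nat.mul_le_mul_left _ hE)
      _ = 52 * m * D * n ^ 3 := by ring
  have h2 : m ^ 2 ≤ 4 * n ^ 3 := by
    obtain ⟨k, hk⟩ : ∃ k, m = k + 1 := ⟨_, hm⟩
    rw [hk, Nat.add_sub_cancel] at hm3
    have : 1 ≤ k := by omega
    rw [hk]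
    nlinarith
  have h3 : n ^ 3 ≤ (104 * D) ^ 2 := by
    refine Nat.le_of_mul_le_mul_right ?_ hn3
    calc n ^ 3 * n ^ 3 = (n ^ 3) ^ 2 := by ring
      _ ≤ (52 * m * D) ^ 2 := by gcongr
      _ = (52 * D) ^ 2 * m ^ 2 := by ring
      _ ≤ (52 * D) ^ 2 * (4 * n ^ 3) := by gcongr
      _ = (104 * D) ^ 2 * n ^ 3 := by ring
  have h4 : (n : ℝ) ^ ((3 : ℝ) / 2) ≤ 104 * D := by
    refine le_of_sq_le_sq ?_ (by positivity)
    rw [← Real.rpow_natCast, ← Real.rpow_mul (Nat.cast_nonneg n)]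
    norm_num
    exact_mod_cast h3
  have h5 : (n : ℝ) ^ ((5 : ℝ) / 4) ≤ (n : ℝ) ^ ((3 : ℝ) / 2) :=
    Real.rpow_le_rpow_of_exponent_le (by exact_mod_cast (by omega : 1 ≤ n)) (by norm_num)
  linarith
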